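/- arXiv:hep-th/0306003 — 7 statements merged into one kernel-verified Lean document; each statement's English description precedes it below -/
import Mathlib

section
/- Let n ≥ 1 and let L, M : ℝ → Matrix (Fin n) (Fin n) ℝ be such that L is differentiable, M is continuous, and the Lax equation L'(t) = M(t)·L(t) − L(t)·M(t) holds for all t ∈ ℝ. Then for every natural number k, the function t ↦ trace((L(t))^k) is constant on ℝ; moreover, if additionally L(t) is invertible for every t, then for every natural number k the function t ↦ trace((L(t)⁻¹)^k) is constant on ℝ. -/
section LaxEquation

variable {A : Type*} [NormedRing A] [NormedAlgebra ℝ A]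

/-- Solutions of a Lax equation are stable under powers. -/
theorem HasDerivAt.pow_of_lax {L : ℝ → A} {m : A} {t : ℝ}
    (h : HasDerivAt L (m * L t - L t * m) t) (k : ℕ) :
    HasDerivAt (fun s => L s ^ k) (m * L t ^ k - L t ^ k * m) t := by
  induction k with
  | zero => simpa using hasDerivAt_const t (1 : A)
  | succ k ih =>
    simp only [pow_succ]
    convert ih.fun_mul h using 1
    noncomm_ring

/-- Solutions of a Lax equation are stable under inversion. -/
theorem HasDerivAt.ringInverse_of_lax [HasSummableGeomSeries A] {L : ℝ → A} {m : A} {t : ℝ}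
    (h : HasDerivAt L (m * L t - L t * m) t) (hu : IsUnit (L t)) :
    HasDerivAt (fun s => Ring.inverse (L s))
      (m * Ring.inverse (L t) - Ring.inverse (L t) * m) t := by
  obtain ⟨u, hu⟩ := hu
  have hinv : HasFDerivAt Ring.inverse _ (L t) := hu ▸ hasFDerivAt_ringInverse (𝕜 := ℝ) u
  refine (hinv.comp_hasDerivAt t h).congr_deriv ?_
  simp [← hu, mul_sub, sub_mul, mul_assoc]

end LaxEquation

open scoped Matrix.Norms.Operator in
/-- A matrix-valued function with entrywise derivative is differentiable. -/
theorem Matrix.hasDerivAt_of_entries {m n : Type*} [Fintype m] [Fintype n]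
    {L : ℝ → Matrix m n ℝ} {L' : Matrix m n ℝ} {t : ℝ}
    (h : ∀ i j, HasDerivAt (fun s => L s i j) (L' i j) t) : HasDerivAt L L' t :=
  hasDerivAt_pi.2 fun i => hasDerivAt_pi.2 (h i)

open scoped Matrix.Norms.Operator in
/-- The trace is constant along a solution of a Lax equation. -/
theorem Matrix.trace_eq_of_lax {n : Type*} [Fintype n] [DecidableEq n] {L M : ℝ → Matrix n n ℝ}
    (h : ∀ t, HasDerivAt L (M t * L t - L t * M t) t) (t s : ℝ) :
    (L t).trace = (L s).trace := by
  have htrace (t : ℝ) : HasDerivAt (fun s => (L s).trace) 0 t := by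
    have := (Matrix.traceLinearMap n ℝ ℝ).toContinuousLinearMap.hasFDerivAt.comp_hasDerivAt t (h t)
    refine this.congr_deriv ?_
    change (M t * L t - L t * M t).trace = 0
    rw [Matrix.trace_sub, Matrix.trace_mul_comm, sub_self]
  exact is_const_of_deriv_eq_zero (fun t => (htrace t).differentiableAt)
    (fun t => (htrace t).deriv) t s

/-- If `L` satisfies the Lax equation `L' = M·L − L·M`, then for every
natural `k` the function `t ↦ trace((L t)^k)` is constant; moreover, if each `L t` is
invertible, the same holds for `t ↦ trace((L t)⁻¹ ^ k)`. -/
theorem trace_powers_constant_of_lax (n : ℕ) (hn : 1 ≤ n)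
    (L M : ℝ → Matrix (Fin n) (Fin n) ℝ)
    (hL : ∀ i j : Fin n, Differentiable ℝ fun t => L t i j)
    (hM : ∀ i j : Fin n, Continuous fun t => M t i j)
    (hLax : ∀ t : ℝ,
      (Matrix.of fun i j : Fin n => deriv (fun s => L s i j) t) = M t * L t - L t * M t) :
    (∀ k : ℕ, ∀ t s : ℝ, Matrix.trace (L t ^ k) = Matrix.trace (L s ^ k)) ∧
      ((∀ t : ℝ, IsUnit (L t)) →
        ∀ k : ℕ, ∀ t s : ℝ, Matrix.trace ((L t)⁻¹ ^ k) = Matrix.trace ((L s)⁻¹ ^ k)) := by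
  open scoped Matrix.Norms.Operator in
  have hderiv (t : ℝ) : HasDerivAt L (M t * L t - L t * M t) t := by
    rw [← hLax t]
    exact Matrix.hasDerivAt_of_entries fun i j => (hL i j t).hasDerivAt
  open scoped Matrix.Norms.Operator in
  refine ⟨fun k => Matrix.trace_eq_of_lax fun t => (hderiv t).pow_of_lax k, fun hu k => ?_⟩
  simp only [Matrix.nonsing_inv_eq_ringInverse]
  open scoped Matrix.Norms.Operator in
  exact Matrix.trace_eq_of_lax fun t => ((hderiv t).ringInverse_of_lax (hu t)).pow_of_lax k
end

section
/- Let R be a (possibly noncommutative) ring, let n ≥ 1 and let m₊, m₋ ≥ 1 be integers. Let L be an n×n matrix over R of strip form with widths (m₊, m₋), i.e. L i j = 0 whenever j − i > m₊ or i − j > m₋. Set M = L^{(>)} − L^{(<)}, where L^{(>)} is the strictly upper triangular part of L and L^{(<)} is the strictly lower triangular part of L. Then the commutator ML − LM is again of strip form with the same widths: (ML − LM) i j = 0 whenever j − i > m₊ or i − j > m₋. -/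
/-- If `L` is an `n×n` matrix over a (possibly noncommutative) ring `R`
of strip form with widths `(m₊, m₋)` and `M = L^{(>)} − L^{(<)}` (strictly upper minus
strictly lower triangular part), then `M*L − L*M` is again of strip form with the same
widths. -/
theorem commutator_strip_form {R : Type*} [Ring R] (n : ℕ) (hn : 1 ≤ n)
    (mp mm : ℕ) (hmp : 1 ≤ mp) (hmm : 1 ≤ mm)
    (L : Matrix (Fin n) (Fin n) R)
    (hstrip : ∀ i j : Fin n,
      ((j.1 : ℤ) - (i.1 : ℤ) > (mp : ℤ) ∨ (i.1 : ℤ) - (j.1 : ℤ) > (mm : ℤ)) → L i j = 0)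
    (M : Matrix (Fin n) (Fin n) R)
    (hM : M = Matrix.of fun i j : Fin n =>
      if i.1 < j.1 then L i j else if j.1 < i.1 then -L i j else 0) :
    ∀ i j : Fin n,
      ((j.1 : ℤ) - (i.1 : ℤ) > (mp : ℤ) ∨ (i.1 : ℤ) - (j.1 : ℤ) > (mm : ℤ)) →
        (M * L - L * M) i j = 0 := by
  intro i j hij
  rw [Matrix.sub_apply, Matrix.mul_apply, Matrix.mul_apply, ← Finset.sum_sub_distrib]
  refine Finset.sum_eq_zero fun k _ => ?_
  by_cases hk : (i < k ∧ k < j) ∨ (j < k ∧ k < i)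
  · rcases hk with ⟨hik, hkj⟩ | ⟨hjk, hki⟩
    · simp [hM, hik, hkj]
    · simp [hM, hjk, hki, hjk.not_gt, hki.not_gt]
  · have hzero : L i k = 0 ∨ L k j = 0 := by
      by_cases hik : (k.1 : ℤ) - i.1 > mp ∨ (i.1 : ℤ) - k.1 > mm
      · exact Or.inl (hstrip i k hik)
      · exact Or.inr (hstrip k j (by omega))
    rcases hzero with h | h <;> simp [hM, h]
end

section
/- Fix integers n ≥ 2 and m₊, m₋ with 1 ≤ m₋ ≤ m₊ ≤ n − 1, and let 𝔸 be a real Banach algebra (possibly noncommutative). Let Q_i : ℝ → 𝔸 (1 ≤ i ≤ n) be twice differentiable and A_i^{(k)} : ℝ → 𝔸 (1 ≤ k ≤ m₊, 1 ≤ i ≤ n−k), C_i^{(k)} : ℝ → 𝔸 (1 ≤ k ≤ m₋, 1 ≤ i ≤ n−k) be differentiable, with the convention that out-of-range variables are 0. Define the time-dependent n×n matrices over 𝔸: L = L^{(0)} + L^{(>)} + L^{(<)} with L^{(0)} diagonal with entries Q̇_i, L^{(>)} having (i,i+k) entry A_i^{(k)}, L^{(<)} having (i+k,i) entry C_i^{(k)},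 and M = L^{(>)} − L^{(<)}. Then the Lax equation L̇ = ML − LM holds for all t if and only if for all t and all in-range indices: (1) Q̈_i = 2 Σ_{k=1}^{m₋} ( A_i^{(k)} C_i^{(k)} − C_{i−k}^{(k)} A_{i−k}^{(k)} ); (2) for 1 ≤ k ≤ m₊ − 1: Ȧ_i^{(k)} = A_i^{(k)} Q̇_{i+k} − Q̇_i A_i^{(k)} + 2 Σ_{k'=1}^{min(m₊−k, m₋)} ( A_i^{(k+k')} C_{i+k}^{(k')} − C_{i−k'}^{(k')} A_{i−k'}^{(k+k')} ); (3) for 1 ≤ k ≤ m₋ − 1: Ċ_i^{(k)} = Q̇_{i+k} C_i^{(k)} − C_i^{(k)} Q̇_i + 2 Σ_{k'=1}^{m₋−k} ( A_{i+k}^{(k')} C_i^{(k+k')} − C_{i−k'}^{(k+k')} A_{i−k'}^{(k')} ); (4) Ȧ_i^{(m₊)} = A_i^{(m₊)} Q̇_{i+m₊} − Q̇_i A_i^{(m₊)}; (5) Ċ_i^{(m₋)} = Q̇_{i+m₋} C_i^{(m₋)} − C_i^{(m₋)} Q̇_i. -/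
namespace TodaChain

open Finset Matrix

section Sums

variable {R : Type*} [AddCommMonoid R] {n : ℕ}

theorem sum_fin_ite_lt_sub (j m : ℕ) (g : ℕ → R) (hg : ∀ k, m < k ∨ n ≤ j + k → g k = 0) :
    ∑ l : Fin n, (if j < l.1 then g (l.1 - j) else 0) = ∑ k ∈ Icc 1 m, g k := by
  rw [Fin.sum_univ_eq_sum_range (fun l => if j < l then g (l - j) else 0), ← sum_filter]
  refine sum_bij_ne_zero (fun l _ _ => l - j) ?_ ?_ ?_ ?_
  · intro l hl h
    have := mt (hg (l - j)) h
    simp only [mem_filter, mem_range, mem_Icc] at *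
    omega
  · intro a ha _ b hb _ h
    simp only [mem_filter, mem_range] at *
    omega
  · intro k hk h
    have := mt (hg k) h
    simp only [mem_Icc] at hk
    exact ⟨j + k, by simp only [mem_filter, mem_range]; omega, by simpa using h, by simp⟩
  · intros; rfl

theorem sum_fin_ite_sub_lt (i m : ℕ) (hi : i ≤ n) (g : ℕ → R)
    (hg : ∀ k, m < k ∨ i < k → g k = 0) :
    ∑ l : Fin n, (if l.1 < i then g (i - l.1) else 0) = ∑ k ∈ Icc 1 m, g k := by
  rw [Fin.sum_univ_eq_sum_range (fun l => if l < i then g (i - l) else 0), ← sum_filter]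
  refine sum_bij_ne_zero (fun l _ _ => i - l) ?_ ?_ ?_ ?_
  · intro l hl h
    have := mt (hg (i - l)) h
    simp only [mem_filter, mem_range, mem_Icc] at *
    omega
  · intro a ha _ b hb _ h
    simp only [mem_filter, mem_range] at *
    omega
  · intro k hk h
    have := mt (hg k) h
    simp only [mem_Icc] at hk
    have hk' : i - (i - k) = k := by omega
    exact ⟨i - k, by simp only [mem_filter, mem_range]; omega, by simpa [hk'] using h, hk'⟩
  · intros; rfl

end Sums

section Entries

variable {R : Type*} [Ring R]

/-- The strictly upper triangular matrix with entry `a k i` at the (1-based) place `(i, i + k)`. -/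
def upper (n : ℕ) (a : ℕ → ℕ → R) : Matrix (Fin n) (Fin n) R :=
  of fun i j => if i.1 < j.1 then a (j.1 - i.1) (i.1 + 1) else 0

/-- The strictly lower triangular matrix with entry `c k i` at the (1-based) place `(i + k, i)`. -/
def lower (n : ℕ) (c : ℕ → ℕ → R) : Matrix (Fin n) (Fin n) R :=
  of fun i j => if j.1 < i.1 then c (i.1 - j.1) (j.1 + 1) else 0

theorem upper_sub_lower_lax {ι : Type*} [Fintype ι] (D U W : Matrix ι ι R) :
    (U - W) * (D + U + W) - (D + U + W) * (U - W) =
      (U * D - D * U) + (D * W - W * D) + ((U * W - W * U) + (U * W - W * U)) := by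
  noncomm_ring

variable {n mp mm : ℕ} {a c : ℕ → ℕ → R}

theorem upper_lower_commutator_apply_of_le
    (ha : ∀ k i : ℕ, ¬(1 ≤ k ∧ k ≤ mp ∧ 1 ≤ i ∧ i + k ≤ n) → a k i = 0)
    (hc : ∀ k i : ℕ, ¬(1 ≤ k ∧ k ≤ mm ∧ 1 ≤ i ∧ i + k ≤ n) → c k i = 0)
    {i j : Fin n} (hij : i.1 ≤ j.1) :
    (upper n a * lower n c - lower n c * upper n a) i j =
      ∑ k' ∈ Icc 1 (min (mp - (j.1 - i.1)) mm),
        (a (j.1 - i.1 + k') (i.1 + 1) * c k' (j.1 + 1)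
          - c k' (i.1 + 1 - k') * a (j.1 - i.1 + k') (i.1 + 1 - k')) := by
  rw [Matrix.sub_apply, mul_apply, mul_apply, sum_sub_distrib]
  congr 1
  · rw [← sum_fin_ite_lt_sub (n := n) j.1]
    · refine sum_congr rfl fun l _ => ?_
      simp only [upper, lower, of_apply]
      split_ifs with h₁ h₂ h₂
      · congr 2; omega
      · simp
      · omega
      · simp
    · intro k hk
      by_cases h : mm < k ∨ n ≤ j.1 + k
      · rw [hc k, mul_zero]; omega
      · rw [ha (j.1 - i.1 + k), zero_mul]; omega
  · rw [← sum_fin_ite_sub_lt (n := n) i.1 _ i.2.le]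
    · refine sum_congr rfl fun l _ => ?_
      simp only [upper, lower, of_apply]
      split_ifs with h₁ h₂ h₂
      · congr 2 <;> omega
      · omega
      · simp
      · simp
    · intro k hk
      by_cases h : mm < k ∨ i.1 < k
      · rw [hc k, zero_mul]; omega
      · rw [ha (j.1 - i.1 + k), mul_zero]; omega

theorem upper_lower_commutator_apply_of_ge
    (ha : ∀ k i : ℕ, ¬(1 ≤ k ∧ k ≤ mp ∧ 1 ≤ i ∧ i + k ≤ n) → a k i = 0)
    (hc : ∀ k i : ℕ, ¬(1 ≤ k ∧ k ≤ mm ∧ 1 ≤ i ∧ i + k ≤ n) → c k i = 0)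
    {i j : Fin n} (hij : j.1 ≤ i.1) :
    (upper n a * lower n c - lower n c * upper n a) i j =
      ∑ k' ∈ Icc 1 (mm - (i.1 - j.1)),
        (a k' (i.1 + 1) * c (i.1 - j.1 + k') (j.1 + 1)
          - c (i.1 - j.1 + k') (j.1 + 1 - k') * a k' (j.1 + 1 - k')) := by
  rw [Matrix.sub_apply, mul_apply, mul_apply, sum_sub_distrib]
  congr 1
  · rw [← sum_fin_ite_lt_sub (n := n) i.1]
    · refine sum_congr rfl fun l _ => ?_
      simp only [upper, lower, of_apply]
      split_ifs with h₁ h₂ h₂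
      · congr 2; omega
      · omega
      · simp
      · simp
    · intro k hk
      by_cases h : mp < k ∨ n ≤ i.1 + k
      · rw [ha k, zero_mul]; omega
      · rw [hc (i.1 - j.1 + k), mul_zero]; omega
  · rw [← sum_fin_ite_sub_lt (n := n) j.1 _ j.2.le]
    · refine sum_congr rfl fun l _ => ?_
      simp only [upper, lower, of_apply]
      split_ifs with h₁ h₂ h₂
      · congr 2 <;> omega
      · simp
      · omega
      · simp
    · intro k hk
      by_cases h : mp < k ∨ j.1 < k
      · rw [ha k, mul_zero]; omega
      · rw [hc (i.1 - j.1 + k), zero_mul]; omega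

end Entries

end TodaChain


/-- For the finite (possibly nonabelian) `(m₊,m₋)`-Toda `n`-chain with
values in a real Banach algebra `𝔸`, the Lax equation `L̇ = ML − LM` holds for all `t`
iff the equations of motion (1)–(5) hold for all `t` and all in-range indices.
Matrix indices are 1-based (a `Fin n` index `i` represents `i.1 + 1`); out-of-range
variables are `0` by hypothesis. -/
theorem nonabelian_toda_lax_iff {𝔸 : Type*} [NormedRing 𝔸] [NormedAlgebra ℝ 𝔸]
    [CompleteSpace 𝔸]
    (n mp mm : ℕ) (hn : 2 ≤ n) (hmm : 1 ≤ mm) (hmmmp : mm ≤ mp) (hmp : mp ≤ n - 1)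
    (Q : ℕ → ℝ → 𝔸) (A C : ℕ → ℕ → ℝ → 𝔸)
    (hQd : ∀ i : ℕ, 1 ≤ i → i ≤ n →
      Differentiable ℝ (Q i) ∧ Differentiable ℝ (deriv (Q i)))
    (hAd : ∀ k i : ℕ, 1 ≤ k → k ≤ mp → 1 ≤ i → i + k ≤ n → Differentiable ℝ (A k i))
    (hCd : ∀ k i : ℕ, 1 ≤ k → k ≤ mm → 1 ≤ i → i + k ≤ n → Differentiable ℝ (C k i))
    (hA0 : ∀ k i : ℕ, ¬(1 ≤ k ∧ k ≤ mp ∧ 1 ≤ i ∧ i + k ≤ n) → A k i = 0)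
    (hC0 : ∀ k i : ℕ, ¬(1 ≤ k ∧ k ≤ mm ∧ 1 ≤ i ∧ i + k ≤ n) → C k i = 0)
    (L M : ℝ → Matrix (Fin n) (Fin n) 𝔸)
    (hL : ∀ t : ℝ, L t = Matrix.of fun i j : Fin n =>
      if i.1 = j.1 then deriv (Q (i.1 + 1)) t
      else if i.1 < j.1 ∧ j.1 - i.1 ≤ mp then A (j.1 - i.1) (i.1 + 1) t
      else if j.1 < i.1 ∧ i.1 - j.1 ≤ mm then C (i.1 - j.1) (j.1 + 1) t
      else 0)
    (hM : ∀ t : ℝ, M t = Matrix.of fun i j : Fin n =>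
      if i.1 < j.1 ∧ j.1 - i.1 ≤ mp then A (j.1 - i.1) (i.1 + 1) t
      else if j.1 < i.1 ∧ i.1 - j.1 ≤ mm then -C (i.1 - j.1) (j.1 + 1) t
      else 0) :
    (∀ t : ℝ,
        (Matrix.of fun i j : Fin n => deriv (fun s => L s i j) t) = M t * L t - L t * M t)
      ↔
      ((∀ t : ℝ, ∀ i : ℕ, 1 ≤ i → i ≤ n →
          deriv (deriv (Q i)) t = (2 : ℝ) • ∑ k ∈ Finset.Icc 1 mm,
            (A k i t * C k i t - C k (i - k) t * A k (i - k) t)) ∧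
        (∀ t : ℝ, ∀ k i : ℕ, 1 ≤ k → k ≤ mp - 1 → 1 ≤ i → i + k ≤ n →
          deriv (A k i) t = A k i t * deriv (Q (i + k)) t - deriv (Q i) t * A k i t
            + (2 : ℝ) • ∑ k' ∈ Finset.Icc 1 (min (mp - k) mm),
                (A (k + k') i t * C k' (i + k) t
                  - C k' (i - k') t * A (k + k') (i - k') t)) ∧
        (∀ t : ℝ, ∀ k i : ℕ, 1 ≤ k → k ≤ mm - 1 → 1 ≤ i → i + k ≤ n →
          deriv (C k i) t = deriv (Q (i + k)) t * C k i t - C k i t * deriv (Q i) t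
            + (2 : ℝ) • ∑ k' ∈ Finset.Icc 1 (mm - k),
                (A k' (i + k) t * C (k + k') i t
                  - C (k + k') (i - k') t * A k' (i - k') t)) ∧
        (∀ t : ℝ, ∀ i : ℕ, 1 ≤ i → i + mp ≤ n →
          deriv (A mp i) t = A mp i t * deriv (Q (i + mp)) t - deriv (Q i) t * A mp i t) ∧
        (∀ t : ℝ, ∀ i : ℕ, 1 ≤ i → i + mm ≤ n →
          deriv (C mm i) t = deriv (Q (i + mm)) t * C mm i t - C mm i t * deriv (Q i) t)) := by
  have hA0' : ∀ t k i, ¬(1 ≤ k ∧ k ≤ mp ∧ 1 ≤ i ∧ i + k ≤ n) → A k i t = 0 :=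
    fun t k i h => by rw [hA0 k i h, Pi.zero_apply]
  have hC0' : ∀ t k i, ¬(1 ≤ k ∧ k ≤ mm ∧ 1 ≤ i ∧ i + k ≤ n) → C k i t = 0 :=
    fun t k i h => by rw [hC0 k i h, Pi.zero_apply]
  let D : ℝ → Matrix (Fin n) (Fin n) 𝔸 :=
    fun t => Matrix.diagonal fun i => deriv (Q (i.1 + 1)) t
  let U : ℝ → Matrix (Fin n) (Fin n) 𝔸 := fun t => TodaChain.upper n fun k i => A k i t
  let W : ℝ → Matrix (Fin n) (Fin n) 𝔸 := fun t => TodaChain.lower n fun k i => C k i t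
  have hLs : ∀ t, L t = D t + U t + W t := by
    intro t
    ext i j
    simp only [hL, D, U, W, TodaChain.upper, TodaChain.lower, Matrix.add_apply, Matrix.of_apply,
      Matrix.diagonal_apply, Fin.ext_iff]
    rcases lt_trichotomy i.1 j.1 with h | h | h
    · by_cases h' : j.1 - i.1 ≤ mp
      · simp [h, h', h.ne, h.not_gt]
      · simp [h, h', h.ne, h.not_gt, hA0' t (j.1 - i.1) (i.1 + 1) (by omega)]
    · simp [h]
    · by_cases h' : i.1 - j.1 ≤ mm
      · simp [h, h', h.ne', h.not_gt]
      · simp [h, h', h.ne', h.not_gt, hC0' t (i.1 - j.1) (j.1 + 1) (by omega)]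
  have hMs : ∀ t, M t = U t - W t := by
    intro t
    ext i j
    simp only [hM, U, W, TodaChain.upper, TodaChain.lower, Matrix.sub_apply, Matrix.of_apply]
    rcases lt_trichotomy i.1 j.1 with h | h | h
    · by_cases h' : j.1 - i.1 ≤ mp
      · simp [h, h', h.not_gt]
      · simp [h, h', h.not_gt, hA0' t (j.1 - i.1) (i.1 + 1) (by omega)]
    · simp [h]
    · by_cases h' : i.1 - j.1 ≤ mm
      · simp [h, h', h.not_gt]
      · simp [h, h', h.not_gt, hC0' t (i.1 - j.1) (j.1 + 1) (by omega)]
  have hlax : ∀ t i j, (M t * L t - L t * M t) i j =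
      (U t i j * deriv (Q (j.1 + 1)) t - deriv (Q (i.1 + 1)) t * U t i j)
        + (deriv (Q (i.1 + 1)) t * W t i j - W t i j * deriv (Q (j.1 + 1)) t)
        + (2 : ℝ) • (U t * W t - W t * U t) i j := by
    intro t i j
    rw [hLs, hMs, TodaChain.upper_sub_lower_lax, two_smul]
    simp only [D, Matrix.add_apply, Matrix.sub_apply, Matrix.mul_diagonal, Matrix.diagonal_mul]
  have hdiag : ∀ t (i j : Fin n), i.1 = j.1 →
      ((deriv (fun s => L s i j) t = (M t * L t - L t * M t) i j) ↔
        deriv (deriv (Q (i.1 + 1))) t = (2 : ℝ) • ∑ k ∈ Finset.Icc 1 mm,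
          (A k (i.1 + 1) t * C k (i.1 + 1) t
            - C k (i.1 + 1 - k) t * A k (i.1 + 1 - k) t)) := by
    intro t i j h
    obtain rfl : i = j := Fin.ext h
    rw [hlax, TodaChain.upper_lower_commutator_apply_of_le (hA0' t) (hC0' t) le_rfl]
    simp [hLs, D, U, W, TodaChain.upper, TodaChain.lower, hmmmp]
  have hupper : ∀ t (i j : Fin n), i.1 < j.1 →
      ((deriv (fun s => L s i j) t = (M t * L t - L t * M t) i j) ↔
        deriv (A (j.1 - i.1) (i.1 + 1)) t =
          A (j.1 - i.1) (i.1 + 1) t * deriv (Q (j.1 + 1)) t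
            - deriv (Q (i.1 + 1)) t * A (j.1 - i.1) (i.1 + 1) t
            + (2 : ℝ) • ∑ k' ∈ Finset.Icc 1 (min (mp - (j.1 - i.1)) mm),
                (A (j.1 - i.1 + k') (i.1 + 1) t * C k' (j.1 + 1) t
                  - C k' (i.1 + 1 - k') t * A (j.1 - i.1 + k') (i.1 + 1 - k') t)) := by
    intro t i j h
    rw [hlax, TodaChain.upper_lower_commutator_apply_of_le (hA0' t) (hC0' t) h.le]
    simp [-Fin.val_fin_lt, hLs, D, U, W, TodaChain.upper, TodaChain.lower, Fin.ext_iff, h,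
      h.ne, h.not_gt]
  have hlower : ∀ t (i j : Fin n), j.1 < i.1 →
      ((deriv (fun s => L s i j) t = (M t * L t - L t * M t) i j) ↔
        deriv (C (i.1 - j.1) (j.1 + 1)) t =
          deriv (Q (i.1 + 1)) t * C (i.1 - j.1) (j.1 + 1) t
            - C (i.1 - j.1) (j.1 + 1) t * deriv (Q (j.1 + 1)) t
            + (2 : ℝ) • ∑ k' ∈ Finset.Icc 1 (mm - (i.1 - j.1)),
                (A k' (i.1 + 1) t * C (i.1 - j.1 + k') (j.1 + 1) t
                  - C (i.1 - j.1 + k') (j.1 + 1 - k') t * A k' (j.1 + 1 - k') t)) := by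
    intro t i j h
    rw [hlax, TodaChain.upper_lower_commutator_apply_of_ge (hA0' t) (hC0' t) h.le]
    simp [-Fin.val_fin_lt, hLs, D, U, W, TodaChain.upper, TodaChain.lower, Fin.ext_iff, h,
      h.ne', h.not_gt]
  constructor
  · intro H
    replace H : ∀ t i j, deriv (fun s => L s i j) t = (M t * L t - L t * M t) i j :=
      fun t i j => congrFun (congrFun (H t) i) j
    have hA : ∀ t k i, 1 ≤ k → 1 ≤ i → i + k ≤ n →
        deriv (A k i) t = A k i t * deriv (Q (i + k)) t - deriv (Q i) t * A k i t
          + (2 : ℝ) • ∑ k' ∈ Finset.Icc 1 (min (mp - k) mm),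
              (A (k + k') i t * C k' (i + k) t
                - C k' (i - k') t * A (k + k') (i - k') t) := by
      intro t k i hk hi hik
      have := (hupper t ⟨i - 1, by omega⟩ ⟨i + k - 1, by omega⟩ (by simp; omega)).1 (H t _ _)
      simpa only [show i + k - 1 - (i - 1) = k by omega, Nat.sub_add_cancel hi,
        show i + k - 1 + 1 = i + k by omega] using this
    have hC : ∀ t k i, 1 ≤ k → 1 ≤ i → i + k ≤ n →
        deriv (C k i) t = deriv (Q (i + k)) t * C k i t - C k i t * deriv (Q i) t
          + (2 : ℝ) • ∑ k' ∈ Finset.Icc 1 (mm - k),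
              (A k' (i + k) t * C (k + k') i t
                - C (k + k') (i - k') t * A k' (i - k') t) := by
      intro t k i hk hi hik
      have := (hlower t ⟨i + k - 1, by omega⟩ ⟨i - 1, by omega⟩ (by simp; omega)).1 (H t _ _)
      simpa only [show i + k - 1 - (i - 1) = k by omega, Nat.sub_add_cancel hi,
        show i + k - 1 + 1 = i + k by omega] using this
    refine ⟨fun t i hi hin => ?_, fun t k i hk _ => hA t k i hk, fun t k i hk _ => hC t k i hk,
      fun t i hi hin => ?_, fun t i hi hin => ?_⟩
    · have := (hdiag t ⟨i - 1, by omega⟩ _ rfl).1 (H t _ _)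
      simpa only [Nat.sub_add_cancel hi] using this
    · simpa using hA t mp i (by omega) hi hin
    · simpa using hC t mm i hmm hi hin
  · rintro ⟨h₁, h₂, h₃, h₄, h₅⟩ t
    ext i j
    rw [Matrix.of_apply]
    rcases lt_trichotomy i.1 j.1 with h | h | h
    · rw [hupper t i j h]
      obtain ⟨k, hk⟩ := Nat.exists_eq_add_of_lt h
      have hj : j.1 + 1 = i.1 + 1 + (k + 1) := by omega
      rw [show j.1 - i.1 = k + 1 by omega, hj]
      rcases lt_trichotomy (k + 1) mp with h' | h' | h'
      · exact h₂ t (k + 1) (i.1 + 1) (by omega) (by omega) (by omega) (by omega)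
      · simpa [h'] using h₄ t (i.1 + 1) (by omega) (by omega)
      · rw [hA0 (k + 1) (i.1 + 1) (by omega), Nat.sub_eq_zero_of_le h'.le]
        simp
    · exact (hdiag t i j h).2 (h₁ t (i.1 + 1) (by omega) (by omega))
    · rw [hlower t i j h]
      obtain ⟨k, hk⟩ := Nat.exists_eq_add_of_lt h
      have hi : i.1 + 1 = j.1 + 1 + (k + 1) := by omega
      rw [show i.1 - j.1 = k + 1 by omega, hi]
      rcases lt_trichotomy (k + 1) mm with h' | h' | h'
      · exact h₃ t (k + 1) (j.1 + 1) (by omega) (by omega) (by omega) (by omega)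
      · simpa [h'] using h₅ t (j.1 + 1) (by omega) (by omega)
      · rw [hC0 (k + 1) (j.1 + 1) (by omega), Nat.sub_eq_zero_of_le h'.le]
        simp
end

section
/- Fix integers n ≥ 2 and m₊, m₋ with 1 ≤ m₋ ≤ m₊ ≤ n − 1. Let q_i : ℝ → ℝ (1 ≤ i ≤ n) be twice differentiable and ψ_i^{+(k)} : ℝ → ℝ (1 ≤ k ≤ m₊ − 1), ψ_i^{−(k)} : ℝ → ℝ (1 ≤ k ≤ m₋ − 1) be differentiable for 1 ≤ i ≤ n − k, with the conventions ψ_i^{+(m₊)} := 1 and ψ_i^{−(m₋)} := 1 for in-range i and ψ_i^{±(k)} := 0 whenever i < 1 or i + k > n. Define the n×n real Lax matrix L(t) with diagonal entries q̇_i, (i,i+k) entries exp(q_{i+k} − q_i)ψ_i^{+(k)} for 1 ≤ k ≤ m₊, (i+k,i) entries exp(q_{i+k} − q_i)ψ_i^{−(k)} for 1 ≤ k ≤ m₋, all other entries zero, and M = L^{(>)} − L^{(<)} (strictly upper minus strictly lower part of L). Then the Lax equation L̇ = ML − LM holds for all t if and only if for all t and all in-range i: q̈_i = 2 Σ_{k=1}^{m₋}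 { ψ_i^{+(k)}ψ_i^{−(k)} exp[2(q_{i+k} − q_i)] − ψ_{i−k}^{−(k)}ψ_{i−k}^{+(k)} exp[2(q_i − q_{i−k})] }; for 1 ≤ k ≤ m₊ − 1: ψ̇_i^{+(k)} = 2 Σ_{k'=1}^{min(m₊−k, m₋)} ( ψ_i^{+(k+k')}ψ_{i+k}^{−(k')} exp[2(q_{i+k+k'} − q_{i+k})] − ψ_{i−k'}^{−(k')}ψ_{i−k'}^{+(k+k')} exp[2(q_i − q_{i−k'})] ); and for 1 ≤ k ≤ m₋ − 1: ψ̇_i^{−(k)} = 2 Σ_{k'=1}^{m₋−k} ( ψ_{i+k}^{+(k')}ψ_i^{−(k+k')} exp[2(q_{i+k+k'} − q_{i+k})] − ψ_{i−k'}^{−(k+k')}ψ_{i−k'}^{+(k')} exp[2(q_i − q_{i−k'})] ). -/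
/-- The strictly upper triangular matrix with `k`-th superdiagonal entries
`exp (x_{i+k} - x_i) u_i^{(k)}` for `1 ≤ k ≤ p` (in one-based indices). -/
noncomputable def todaUpper (n p : ℕ) (u : ℕ → ℕ → ℝ) (x : ℕ → ℝ) : Matrix (Fin n) (Fin n) ℝ :=
  Matrix.of fun i j =>
    if i.1 < j.1 ∧ j.1 - i.1 ≤ p then
      Real.exp (x (j.1 + 1) - x (i.1 + 1)) * u (j.1 - i.1) (i.1 + 1)
    else 0

lemma sum_range_eq_sum_Icc_add {n s K : ℕ} {F : ℕ → ℝ} (h₁ : ∀ l ≤ s, F l = 0)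
    (h₂ : ∀ l, s + K < l → F l = 0) (h₃ : ∀ l, n ≤ l → F l = 0) :
    ∑ l ∈ Finset.range n, F l = ∑ k ∈ Finset.Icc 1 K, F (s + k) := by
  symm
  refine Finset.sum_bij_ne_zero (fun k _ _ => s + k) ?_ ?_ ?_ ?_
  · intro k _ hk
    rw [Finset.mem_range]
    by_contra! h
    exact hk (h₃ _ h)
  · intros; omega
  · intro l _ hl
    have h1 : s < l := by
      by_contra! h
      exact hl (h₁ _ h)
    have h2 : l ≤ s + K := by
      by_contra! h
      exact hl (h₂ _ h)
    refine ⟨l - s, Finset.mem_Icc.2 ⟨by omega, by omega⟩, ?_, by omega⟩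
    rwa [Nat.add_sub_cancel' h1.le]
  · intros; rfl

lemma sum_range_eq_sum_Icc_sub {n s K : ℕ} {F G : ℕ → ℝ} (hs : s < n) (h₁ : ∀ l, s ≤ l → F l = 0)
    (h₂ : ∀ l, l + K < s → F l = 0) (h₃ : ∀ k, s < k → G k = 0)
    (h₄ : ∀ k ∈ Finset.Icc 1 K, k ≤ s → G k = F (s - k)) :
    ∑ l ∈ Finset.range n, F l = ∑ k ∈ Finset.Icc 1 K, G k := by
  symm
  have hle : ∀ k, G k ≠ 0 → k ≤ s := fun k hk => by
    by_contra! h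
    exact hk (h₃ _ h)
  refine Finset.sum_bij_ne_zero (fun k _ _ => s - k) ?_ ?_ ?_ ?_
  · intro k _ _
    rw [Finset.mem_range]
    omega
  · intro a _ ha b _ hb hab
    have := hle a ha
    have := hle b hb
    omega
  · intro l _ hl
    have h1 : l < s := by
      by_contra! h
      exact hl (h₁ _ h)
    have h2 : s ≤ l + K := by
      by_contra! h
      exact hl (h₂ _ h)
    have hm : s - l ∈ Finset.Icc 1 K := Finset.mem_Icc.2 ⟨by omega, by omega⟩
    refine ⟨s - l, hm, ?_, by omega⟩
    rwa [h₄ _ hm (by omega), Nat.sub_sub_self h1.le]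
  · intro k hk hk0
    exact h₄ k hk (hle k hk0)

section

variable {n p m : ℕ} {u v : ℕ → ℕ → ℝ} {x : ℕ → ℝ}

open Matrix in
lemma todaUpper_mul_transpose_apply (hu : ∀ k i, (i < 1 ∨ i + k > n) → u k i = 0)
    {i j : Fin n} {k : ℕ} (hj : j.1 = i.1 + k) :
    (todaUpper n p u x * (todaUpper n m v x)ᵀ) i j =
      Real.exp (x (i.1 + 1 + k) - x (i.1 + 1)) * ∑ l ∈ Finset.Icc 1 (min (p - k) m),
        u (k + l) (i.1 + 1) * v l (i.1 + 1 + k) *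
          Real.exp (2 * (x (i.1 + 1 + k + l) - x (i.1 + 1 + k))) := by
  simp only [Matrix.mul_apply, Matrix.transpose_apply, todaUpper, Matrix.of_apply]
  rw [Fin.sum_univ_eq_sum_range (fun l : ℕ =>
    (if i.1 < l ∧ l - i.1 ≤ p then
        Real.exp (x (l + 1) - x (i.1 + 1)) * u (l - i.1) (i.1 + 1) else 0) *
      (if j.1 < l ∧ l - j.1 ≤ m then
        Real.exp (x (l + 1) - x (j.1 + 1)) * v (l - j.1) (j.1 + 1) else 0)) n,
    sum_range_eq_sum_Icc_add (s := j.1) (K := min (p - k) m), Finset.mul_sum]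
  · refine Finset.sum_congr rfl fun l hl => ?_
    rw [Finset.mem_Icc] at hl
    rw [if_pos (by omega), if_pos (by omega), show j.1 + l - i.1 = k + l by omega,
      show j.1 + l - j.1 = l by omega, show j.1 + l + 1 = i.1 + 1 + k + l by omega,
      show j.1 + 1 = i.1 + 1 + k by omega]
    have : Real.exp (x (i.1 + 1 + k + l) - x (i.1 + 1)) *
        Real.exp (x (i.1 + 1 + k + l) - x (i.1 + 1 + k)) =
        Real.exp (x (i.1 + 1 + k) - x (i.1 + 1)) *
          Real.exp (2 * (x (i.1 + 1 + k + l) - x (i.1 + 1 + k))) := by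
      rw [← Real.exp_add, ← Real.exp_add]
      ring_nf
    linear_combination (u (k + l) (i.1 + 1) * v l (i.1 + 1 + k)) * this
  · intro l hl
    rw [if_neg (c := j.1 < l ∧ _) (by omega), mul_zero]
  · intro l hl
    by_cases h : l - i.1 ≤ p
    · rw [if_neg (c := j.1 < l ∧ _) (by omega), mul_zero]
    · rw [if_neg (by omega), zero_mul]
  · intro l hl
    rw [hu (l - i.1) (i.1 + 1) (by omega)]
    simp

open Matrix in
lemma transpose_todaUpper_mul_apply (hu : ∀ k i, (i < 1 ∨ i + k > n) → u k i = 0)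
    {i j : Fin n} {k : ℕ} (hj : j.1 = i.1 + k) :
    ((todaUpper n m v x)ᵀ * todaUpper n p u x) i j =
      Real.exp (x (i.1 + 1 + k) - x (i.1 + 1)) * ∑ l ∈ Finset.Icc 1 (min (p - k) m),
        v l (i.1 + 1 - l) * u (k + l) (i.1 + 1 - l) *
          Real.exp (2 * (x (i.1 + 1) - x (i.1 + 1 - l))) := by
  simp only [Matrix.mul_apply, Matrix.transpose_apply, todaUpper, Matrix.of_apply]
  rw [Fin.sum_univ_eq_sum_range (fun l : ℕ =>
    (if l < i.1 ∧ i.1 - l ≤ m then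
        Real.exp (x (i.1 + 1) - x (l + 1)) * v (i.1 - l) (l + 1) else 0) *
      (if l < j.1 ∧ j.1 - l ≤ p then
        Real.exp (x (j.1 + 1) - x (l + 1)) * u (j.1 - l) (l + 1) else 0)) n,
    Finset.mul_sum]
  refine sum_range_eq_sum_Icc_sub i.2 ?_ ?_ ?_ ?_
  · intro l hl
    rw [if_neg (by omega), zero_mul]
  · intro l hl
    by_cases h : i.1 - l ≤ m
    · rw [if_neg (c := l < j.1 ∧ _) (by omega), mul_zero]
    · rw [if_neg (by omega), zero_mul]
  · intro l hl
    rw [hu (k + l) (i.1 + 1 - l) (by omega)]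
    simp
  · intro l hl hli
    rw [Finset.mem_Icc] at hl
    rw [if_pos (by omega), if_pos (by omega), show i.1 - (i.1 - l) = l by omega,
      show j.1 - (i.1 - l) = k + l by omega, show i.1 - l + 1 = i.1 + 1 - l by omega,
      show j.1 + 1 = i.1 + 1 + k by omega]
    have : Real.exp (x (i.1 + 1) - x (i.1 + 1 - l)) *
        Real.exp (x (i.1 + 1 + k) - x (i.1 + 1 - l)) =
        Real.exp (x (i.1 + 1 + k) - x (i.1 + 1)) *
          Real.exp (2 * (x (i.1 + 1) - x (i.1 + 1 - l))) := by
      rw [← Real.exp_add, ← Real.exp_add]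
      ring_nf
    linear_combination -(v l (i.1 + 1 - l) * u (k + l) (i.1 + 1 - l)) * this

/-- The commutator `[U - W, D + U + W]`, where `D`, `U`, `W` are the diagonal, strictly upper and
strictly lower parts of the Lax matrix. -/
noncomputable def todaComm (n p m : ℕ) (u v : ℕ → ℕ → ℝ) (x : ℕ → ℝ) (d : Fin n → ℝ) :
    Matrix (Fin n) (Fin n) ℝ :=
  (todaUpper n p u x - (todaUpper n m v x).transpose) *
      (Matrix.diagonal d + todaUpper n p u x + (todaUpper n m v x).transpose) -
    (Matrix.diagonal d + todaUpper n p u x + (todaUpper n m v x).transpose) *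
      (todaUpper n p u x - (todaUpper n m v x).transpose)

lemma transpose_todaComm (d : Fin n → ℝ) :
    (todaComm n p m u v x d).transpose = todaComm n m p v u x d := by
  simp only [todaComm, Matrix.transpose_sub, Matrix.transpose_mul, Matrix.transpose_add,
    Matrix.transpose_transpose, Matrix.diagonal_transpose]
  noncomm_ring

lemma todaComm_apply (hu : ∀ k i, (i < 1 ∨ i + k > n) → u k i = 0) (d : Fin n → ℝ)
    {i j : Fin n} {k : ℕ} (hj : j.1 = i.1 + k) :
    todaComm n p m u v x d i j = todaUpper n p u x i j * (d j - d i) +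
      Real.exp (x (i.1 + 1 + k) - x (i.1 + 1)) * (2 * ∑ l ∈ Finset.Icc 1 (min (p - k) m),
        (u (k + l) (i.1 + 1) * v l (i.1 + 1 + k) *
            Real.exp (2 * (x (i.1 + 1 + k + l) - x (i.1 + 1 + k))) -
          v l (i.1 + 1 - l) * u (k + l) (i.1 + 1 - l) *
            Real.exp (2 * (x (i.1 + 1) - x (i.1 + 1 - l))))) := by
  have hV : (todaUpper n m v x).transpose i j = 0 := by
    simp only [Matrix.transpose_apply, todaUpper, Matrix.of_apply]
    rw [if_neg (by omega)]
  have h : todaComm n p m u v x d =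
      todaUpper n p u x * Matrix.diagonal d - Matrix.diagonal d * todaUpper n p u x -
        ((todaUpper n m v x).transpose * Matrix.diagonal d -
          Matrix.diagonal d * (todaUpper n m v x).transpose) +
      (2 : ℝ) • (todaUpper n p u x * (todaUpper n m v x).transpose -
        (todaUpper n m v x).transpose * todaUpper n p u x) := by
    rw [two_smul, todaComm]
    noncomm_ring
  rw [h]
  simp only [Matrix.add_apply, Matrix.sub_apply, Matrix.smul_apply, Matrix.mul_diagonal,
    Matrix.diagonal_mul, smul_eq_mul, todaUpper_mul_transpose_apply hu hj,
    transpose_todaUpper_mul_apply hu hj, Finset.sum_sub_distrib, hV]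
  ring

end

lemma deriv_todaUpper_eq_todaComm_iff {n p m : ℕ} {q : ℕ → ℝ → ℝ} {ψ φ : ℕ → ℕ → ℝ → ℝ}
    (hq : ∀ i : ℕ, 1 ≤ i → i ≤ n → Differentiable ℝ (q i))
    (hψ : ∀ k i : ℕ, 1 ≤ k → k ≤ p - 1 → 1 ≤ i → i + k ≤ n → Differentiable ℝ (ψ k i))
    (hψtop : ∀ i : ℕ, 1 ≤ i → i + p ≤ n → ψ p i = fun _ => (1 : ℝ))
    (hψ0 : ∀ k i : ℕ, (i < 1 ∨ i + k > n) → ψ k i = 0)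
    (t : ℝ) {i j : Fin n} {k : ℕ} (hk : 1 ≤ k) (hj : j.1 = i.1 + k) :
    deriv (fun s => todaUpper n p (fun k i => ψ k i s) (fun i => q i s) i j) t =
        todaComm n p m (fun k i => ψ k i t) (fun k i => φ k i t) (fun i => q i t)
          (fun i => deriv (q (i.1 + 1)) t) i j ↔
      (k ≤ p - 1 → deriv (ψ k (i.1 + 1)) t = 2 * ∑ l ∈ Finset.Icc 1 (min (p - k) m),
        (ψ (k + l) (i.1 + 1) t * φ l (i.1 + 1 + k) t *
            Real.exp (2 * (q (i.1 + 1 + k + l) t - q (i.1 + 1 + k) t)) -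
          φ l (i.1 + 1 - l) t * ψ (k + l) (i.1 + 1 - l) t *
            Real.exp (2 * (q (i.1 + 1) t - q (i.1 + 1 - l) t)))) := by
  have hjn := j.2
  rw [todaComm_apply (fun k i h => by rw [hψ0 k i h]; rfl) _ hj]
  simp only [todaUpper, Matrix.of_apply]
  rw [show j.1 - i.1 = k by omega, show j.1 + 1 = i.1 + 1 + k by omega]
  by_cases hkp : k ≤ p
  · simp only [hkp, show i.1 < j.1 by omega, and_self, if_true]
    have hd : Differentiable ℝ (ψ k (i.1 + 1)) := by
      rcases hkp.lt_or_eq with h | rfl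
      · exact hψ k _ hk (by omega) (by omega) (by omega)
      · rw [hψtop _ (by omega) (by omega)]
        exact differentiable_const _
    have hder := ((((hq (i.1 + 1 + k) (by omega) (by omega) t).hasDerivAt.sub
      (hq (i.1 + 1) (by omega) (by omega) t).hasDerivAt).exp).mul (hd t).hasDerivAt).deriv
    have hder' : deriv (fun s => Real.exp (q (i.1 + 1 + k) s - q (i.1 + 1) s) *
        ψ k (i.1 + 1) s) t = _ := hder
    rw [hder']
    simp only [Pi.sub_apply]
    have key : ∀ E A B y z : ℝ, E ≠ 0 → (E * A * B + E * y = E * B * A + E * z ↔ y = z) := by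
      intro E A B y z hE
      rw [mul_right_comm E A B, add_right_inj, mul_right_inj' hE]
    rw [key _ _ _ _ _ (Real.exp_ne_zero _)]
    rcases hkp.lt_or_eq with h | rfl
    · simp only [show k ≤ p - 1 by omega, forall_const]
    · simp [hψtop (i.1 + 1) (by omega) (by omega), show ¬ k ≤ k - 1 by omega]
  · simp [hkp, show ¬ k ≤ p - 1 by omega, show p - k = 0 by omega]

/-- For the finite abelian `(m₊,m₋)`-Toda `n`-chain in exponential
variables, the Lax equation `L̇ = ML − LM` holds for all `t` iff the equations of
motion for `q̈_i`, `ψ̇⁺` and `ψ̇⁻` hold for all `t` and all in-range indices.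
Matrix indices are 1-based (a `Fin n` index `i` represents `i.1 + 1`);
`ψp mp i = 1` and `ψm mm i = 1` for in-range `i`, and `ψp k i = ψm k i = 0` whenever
`i < 1` or `i + k > n`, so that every out-of-range term vanishes. -/
theorem abelian_toda_lax_iff
    (n mp mm : ℕ) (hn : 2 ≤ n) (hmm : 1 ≤ mm) (hmmmp : mm ≤ mp) (hmp : mp ≤ n - 1)
    (q : ℕ → ℝ → ℝ) (ψp ψm : ℕ → ℕ → ℝ → ℝ)
    (hqd : ∀ i : ℕ, 1 ≤ i → i ≤ n →
      Differentiable ℝ (q i) ∧ Differentiable ℝ (deriv (q i)))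
    (hψpd : ∀ k i : ℕ, 1 ≤ k → k ≤ mp - 1 → 1 ≤ i → i + k ≤ n →
      Differentiable ℝ (ψp k i))
    (hψmd : ∀ k i : ℕ, 1 ≤ k → k ≤ mm - 1 → 1 ≤ i → i + k ≤ n →
      Differentiable ℝ (ψm k i))
    (hψptop : ∀ i : ℕ, 1 ≤ i → i + mp ≤ n → ψp mp i = fun _ => (1 : ℝ))
    (hψmtop : ∀ i : ℕ, 1 ≤ i → i + mm ≤ n → ψm mm i = fun _ => (1 : ℝ))
    (hψp0 : ∀ k i : ℕ, (i < 1 ∨ i + k > n) → ψp k i = 0)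
    (hψm0 : ∀ k i : ℕ, (i < 1 ∨ i + k > n) → ψm k i = 0)
    (L M : ℝ → Matrix (Fin n) (Fin n) ℝ)
    (hL : ∀ t : ℝ, L t = Matrix.of fun i j : Fin n =>
      if i.1 = j.1 then deriv (q (i.1 + 1)) t
      else if i.1 < j.1 ∧ j.1 - i.1 ≤ mp then
        Real.exp (q (j.1 + 1) t - q (i.1 + 1) t) * ψp (j.1 - i.1) (i.1 + 1) t
      else if j.1 < i.1 ∧ i.1 - j.1 ≤ mm then
        Real.exp (q (i.1 + 1) t - q (j.1 + 1) t) * ψm (i.1 - j.1) (j.1 + 1) t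
      else 0)
    (hM : ∀ t : ℝ, M t = Matrix.of fun i j : Fin n =>
      if i.1 < j.1 ∧ j.1 - i.1 ≤ mp then
        Real.exp (q (j.1 + 1) t - q (i.1 + 1) t) * ψp (j.1 - i.1) (i.1 + 1) t
      else if j.1 < i.1 ∧ i.1 - j.1 ≤ mm then
        -(Real.exp (q (i.1 + 1) t - q (j.1 + 1) t) * ψm (i.1 - j.1) (j.1 + 1) t)
      else 0) :
    (∀ t : ℝ,
        (Matrix.of fun i j : Fin n => deriv (fun s => L s i j) t) = M t * L t - L t * M t)
      ↔
      ((∀ t : ℝ, ∀ i : ℕ, 1 ≤ i → i ≤ n →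
          deriv (deriv (q i)) t = 2 * ∑ k ∈ Finset.Icc 1 mm,
            (ψp k i t * ψm k i t * Real.exp (2 * (q (i + k) t - q i t))
              - ψm k (i - k) t * ψp k (i - k) t * Real.exp (2 * (q i t - q (i - k) t)))) ∧
        (∀ t : ℝ, ∀ k i : ℕ, 1 ≤ k → k ≤ mp - 1 → 1 ≤ i → i + k ≤ n →
          deriv (ψp k i) t = 2 * ∑ k' ∈ Finset.Icc 1 (min (mp - k) mm),
            (ψp (k + k') i t * ψm k' (i + k) t
                * Real.exp (2 * (q (i + k + k') t - q (i + k) t))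
              - ψm k' (i - k') t * ψp (k + k') (i - k') t
                * Real.exp (2 * (q i t - q (i - k') t)))) ∧
        (∀ t : ℝ, ∀ k i : ℕ, 1 ≤ k → k ≤ mm - 1 → 1 ≤ i → i + k ≤ n →
          deriv (ψm k i) t = 2 * ∑ k' ∈ Finset.Icc 1 (mm - k),
            (ψp k' (i + k) t * ψm (k + k') i t
                * Real.exp (2 * (q (i + k + k') t - q (i + k) t))
              - ψm (k + k') (i - k') t * ψp k' (i - k') t
                * Real.exp (2 * (q i t - q (i - k') t))))) := by
  have hq : ∀ i : ℕ, 1 ≤ i → i ≤ n → Differentiable ℝ (q i) := fun i h₁ h₂ => (hqd i h₁ h₂).1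
  have hcomm : ∀ t, M t * L t - L t * M t = todaComm n mp mm (fun k i => ψp k i t)
      (fun k i => ψm k i t) (fun i => q i t) (fun i => deriv (q (i.1 + 1)) t) := by
    intro t
    have hM' : M t = todaUpper n mp (fun k i => ψp k i t) (fun i => q i t) -
        (todaUpper n mm (fun k i => ψm k i t) (fun i => q i t)).transpose := by
      rw [hM]
      ext i j
      simp only [Matrix.sub_apply, Matrix.transpose_apply, todaUpper, Matrix.of_apply]
      by_cases h : i.1 < j.1 ∧ j.1 - i.1 ≤ mp
      · rw [if_pos h, if_pos h, if_neg (by omega), sub_zero]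
      · rw [if_neg h, if_neg h]
        split_ifs <;> simp
    have hL' : L t = Matrix.diagonal (fun i : Fin n => deriv (q (i.1 + 1)) t) +
        todaUpper n mp (fun k i => ψp k i t) (fun i => q i t) +
        (todaUpper n mm (fun k i => ψm k i t) (fun i => q i t)).transpose := by
      rw [hL]
      ext i j
      simp only [Matrix.add_apply, Matrix.transpose_apply, todaUpper, Matrix.of_apply,
        Matrix.diagonal_apply, Fin.ext_iff]
      by_cases h0 : i.1 = j.1
      · simp [h0]
      · by_cases h : i.1 < j.1 ∧ j.1 - i.1 ≤ mp
        · rw [if_neg h0, if_neg h0, if_pos h, if_pos h, if_neg (by omega)]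
          ring
        · rw [if_neg h0, if_neg h0, if_neg h, if_neg h]
          split_ifs <;> simp
    rw [hM', hL', todaComm]
  have hdiag : ∀ i : Fin n, (fun s => L s i i) = deriv (q (i.1 + 1)) := by
    intro i
    funext s
    simp [hL]
  have hup : ∀ i j : Fin n, i.1 < j.1 → (fun s => L s i j) =
      fun s => todaUpper n mp (fun k i => ψp k i s) (fun i => q i s) i j := by
    intro i j hij
    funext s
    simp only [hL, todaUpper, Matrix.of_apply]
    rw [if_neg (by omega)]
    split_ifs <;> first | rfl | omega
  have hlow : ∀ i j : Fin n, i.1 < j.1 → (fun s => L s j i) =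
      fun s => todaUpper n mm (fun k i => ψm k i s) (fun i => q i s) i j := by
    intro i j hij
    funext s
    simp only [hL, todaUpper, Matrix.of_apply]
    rw [if_neg (by omega), if_neg (by omega)]
  have hdiag_iff : ∀ t (i : Fin n), deriv (fun s => L s i i) t =
        (M t * L t - L t * M t) i i ↔
      deriv (deriv (q (i.1 + 1))) t = 2 * ∑ k ∈ Finset.Icc 1 mm,
        (ψp k (i.1 + 1) t * ψm k (i.1 + 1) t *
            Real.exp (2 * (q (i.1 + 1 + k) t - q (i.1 + 1) t))
          - ψm k (i.1 + 1 - k) t * ψp k (i.1 + 1 - k) t *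
            Real.exp (2 * (q (i.1 + 1) t - q (i.1 + 1 - k) t))) := by
    intro t i
    rw [hdiag, hcomm, todaComm_apply (k := 0) (fun k i h => by rw [hψp0 k i h]; rfl) _ rfl]
    simp [min_eq_right hmmmp]
  have hup_iff : ∀ t (i j : Fin n), i.1 < j.1 →
      (deriv (fun s => L s i j) t = (M t * L t - L t * M t) i j ↔
        deriv (fun s => todaUpper n mp (fun k i => ψp k i s) (fun i => q i s) i j) t =
          todaComm n mp mm (fun k i => ψp k i t) (fun k i => ψm k i t) (fun i => q i t)
            (fun i => deriv (q (i.1 + 1)) t) i j) := fun t i j hij => by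
    rw [hup i j hij, hcomm]
  have hlow_iff : ∀ t (i j : Fin n), i.1 < j.1 →
      (deriv (fun s => L s j i) t = (M t * L t - L t * M t) j i ↔
        deriv (fun s => todaUpper n mm (fun k i => ψm k i s) (fun i => q i s) i j) t =
          todaComm n mm mp (fun k i => ψm k i t) (fun k i => ψp k i t) (fun i => q i t)
            (fun i => deriv (q (i.1 + 1)) t) i j) := fun t i j hij => by
    rw [hlow i j hij, hcomm, ← Matrix.transpose_apply (todaComm _ _ _ _ _ _ _),
      transpose_todaComm]
  have hswap : ∀ t k i, 1 ≤ k → ∑ l ∈ Finset.Icc 1 (min (mm - k) mp),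
        (ψm (k + l) i t * ψp l (i + k) t * Real.exp (2 * (q (i + k + l) t - q (i + k) t)) -
          ψp l (i - l) t * ψm (k + l) (i - l) t * Real.exp (2 * (q i t - q (i - l) t))) =
      ∑ l ∈ Finset.Icc 1 (mm - k),
        (ψp l (i + k) t * ψm (k + l) i t * Real.exp (2 * (q (i + k + l) t - q (i + k) t)) -
          ψm (k + l) (i - l) t * ψp l (i - l) t * Real.exp (2 * (q i t - q (i - l) t))) := by
    intro t k i hk
    rw [min_eq_left (by omega)]
    refine Finset.sum_congr rfl fun l _ => ?_
    ring
  constructor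
  · intro h
    have h' : ∀ t (i j : Fin n), deriv (fun s => L s i j) t = (M t * L t - L t * M t) i j :=
      fun t i j => congrFun (congrFun (h t) i) j
    refine ⟨fun t i hi hin => ?_, fun t k i hk hkp hi hik => ?_, fun t k i hk hkp hi hik => ?_⟩ <;>
      obtain ⟨a, rfl⟩ := Nat.exists_eq_add_of_le' hi
    · exact (hdiag_iff t ⟨a, by omega⟩).1 (h' t _ _)
    · exact (deriv_todaUpper_eq_todaComm_iff hq hψpd hψptop hψp0 t hk rfl).1
        ((hup_iff t ⟨a, by omega⟩ ⟨a + k, by omega⟩ (Nat.lt_add_of_pos_right hk)).1 (h' t _ _)) hkp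
    · rw [← hswap t k _ hk]
      exact (deriv_todaUpper_eq_todaComm_iff hq hψmd hψmtop hψm0 t hk rfl).1
        ((hlow_iff t ⟨a, by omega⟩ ⟨a + k, by omega⟩ (Nat.lt_add_of_pos_right hk)).1 (h' t _ _)) hkp
  · rintro ⟨h₀, hp, hm⟩ t
    ext i j
    rw [Matrix.of_apply]
    rcases lt_trichotomy i.1 j.1 with hij | hij | hij
    · obtain ⟨k, hk⟩ := Nat.exists_eq_add_of_le hij.le
      exact (hup_iff t i j hij).2 <|
        (deriv_todaUpper_eq_todaComm_iff hq hψpd hψptop hψp0 t (by omega) hk).2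
        fun hkp => hp t k _ (by omega) hkp (by omega) (by omega)
    · obtain rfl := Fin.ext hij
      exact (hdiag_iff t i).2 (h₀ t _ (by omega) (by omega))
    · obtain ⟨k, hk⟩ := Nat.exists_eq_add_of_le hij.le
      refine (hlow_iff t j i hij).2 <|
        (deriv_todaUpper_eq_todaComm_iff hq hψmd hψmtop hψm0 t (by omega) hk).2
        fun hkp => ?_
      rw [hswap t k _ (by omega)]
      exact hm t k _ (by omega) hkp (by omega) (by omega)
end

section
/- Let n ≥ 1 and for an n×n real matrix X define R(X) := X^{(>)} − X^{(<)}, where X^{(>)} and X^{(<)} are the strictly upper and strictly lower triangular parts of X. Define the R-bracket [X,Y]_R := [R(X), Y] + [X, R(Y)], where [A,B] = AB − BA. Then [·,·]_R satisfies the Jacobi identity: for all n×n real matrices X, Y, Z, [[X,Y]_R, Z]_R + [[Y,Z]_R, X]_R + [[Z,X]_R, Y]_R = 0. -/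
/-- In a ring, an additive map satisfying the modified classical Yang–Baxter equation
`[R x, R y] - R ([R x, y] + [x, R y]) = -[x, y]` induces a bracket satisfying the Jacobi identity. -/
theorem jacobi_of_modified_yangBaxter {A : Type*} [Ring A] (R : A → A) (br : A → A → A)
    (hbr : ∀ x y, br x y = (R x * y - y * R x) + (x * R y - R y * x))
    (hyb : ∀ x y, R (br x y) = (R x * R y - R y * R x) + (x * y - y * x)) (x y z : A) :
    br (br x y) z + br (br y z) x + br (br z x) y = 0 := by
  rw [hbr (br x y), hbr (br y z), hbr (br z x), hyb, hyb, hyb, hbr, hbr, hbr]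
  noncomm_ring

namespace Matrix

/-- The strictly upper triangular part of a matrix minus its strictly lower triangular part. -/
def upperSubLower {ι S : Type*} [LinearOrder ι] [Ring S] (X : Matrix ι ι S) : Matrix ι ι S :=
  of fun i j => if i < j then X i j else if j < i then -X i j else 0

theorem upperSubLower_modified_yangBaxter {ι S : Type*} [LinearOrder ι] [Fintype ι] [CommRing S]
    (X Y : Matrix ι ι S) :
    upperSubLower ((upperSubLower X * Y - Y * upperSubLower X) +
        (X * upperSubLower Y - upperSubLower Y * X)) =
      (upperSubLower X * upperSubLower Y - upperSubLower Y * upperSubLower X) +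
        (X * Y - Y * X) := by
  ext i j
  simp only [upperSubLower, of_apply, add_apply, sub_apply, mul_apply,
    ← Finset.sum_sub_distrib, ← Finset.sum_add_distrib]
  rcases lt_trichotomy i j with h | rfl | h
  · rw [if_pos h]
    refine Finset.sum_congr rfl fun k _ => ?_
    grind
  · rw [if_neg (lt_irrefl i), if_neg (lt_irrefl i)]
    refine (Finset.sum_eq_zero fun k _ => ?_).symm
    grind
  · rw [if_neg h.not_gt, if_pos h, ← Finset.sum_neg_distrib]
    refine Finset.sum_congr rfl fun k _ => ?_
    grind

end Matrix

/-- The R-bracket `[X,Y]_R = [R(X),Y] + [X,R(Y)]`, with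
`R(X) = X^{(>)} − X^{(<)}` (strictly upper minus strictly lower triangular part),
satisfies the Jacobi identity on `n×n` real matrices. -/
theorem r_bracket_jacobi (n : ℕ) (hn : 1 ≤ n)
    (Rop : Matrix (Fin n) (Fin n) ℝ → Matrix (Fin n) (Fin n) ℝ)
    (hR : ∀ X : Matrix (Fin n) (Fin n) ℝ, Rop X = Matrix.of fun i j : Fin n =>
      if i.1 < j.1 then X i j else if j.1 < i.1 then -X i j else 0)
    (br : Matrix (Fin n) (Fin n) ℝ → Matrix (Fin n) (Fin n) ℝ → Matrix (Fin n) (Fin n) ℝ)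
    (hbr : ∀ X Y : Matrix (Fin n) (Fin n) ℝ,
      br X Y = (Rop X * Y - Y * Rop X) + (X * Rop Y - Rop Y * X)) :
    ∀ X Y Z : Matrix (Fin n) (Fin n) ℝ,
      br (br X Y) Z + br (br Y Z) X + br (br Z X) Y = 0 := by
  obtain rfl : Rop = Matrix.upperSubLower := funext hR
  refine jacobi_of_modified_yangBaxter _ br hbr fun X Y => ?_
  rw [hbr, Matrix.upperSubLower_modified_yangBaxter]
end

section
/- Let n ≥ 5 and let q_i, p_i, ψ_i (indices i taken modulo n) be real numbers. Set a_i^{(1)} := exp(q_{i+1} − q_i)·ψ_i, a_i^{(2)} := exp(q_{i+2} − q_i), c_i^{(1)} := exp(q_{i+1} − q_i), with indices of q understood modulo n. For w ∈ ℂ, w ≠ 0, let L(w) be the n×n complex matrix (rows and columns indexed by 0,…,n−1) with entries: L(w)_{ii} = p_i; L(w)_{i,i+1} = a_i^{(1)} for 0 ≤ i ≤ n−2; L(w)_{i,i+2} = a_i^{(2)} for 0 ≤ i ≤ n−3; L(w)_{i+1,i} = c_i^{(1)} for 0 ≤ i ≤ n−2; L(w)_{0,n−1} = w·c_{n−1}^{(1)};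 L(w)_{n−2,0} = w⁻¹·a_{n−2}^{(2)}; L(w)_{n−1,0} = w⁻¹·a_{n−1}^{(1)}; L(w)_{n−1,1} = w⁻¹·a_{n−1}^{(2)}; all other entries zero. Then there exist polynomials P and Q with real coefficients, with deg P = n and deg Q ≤ n − 3, independent of w, such that for all λ ∈ ℂ and all w ∈ ℂ with w ≠ 0: det(L(w) − λ·1) = (−1)^{n−1}·w + Q(λ)/w + 1/w² + P(λ). -/
/-- The entry `a_i^{(1)} = exp(q_{i+1} − q_i)·ψ_i` of the periodic (2,1)-Toda Lax
matrix. -/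
noncomputable def todaA1 (q ψ : ℤ → ℝ) (i : ℤ) : ℝ := Real.exp (q (i + 1) - q i) * ψ i

/-- The entry `a_i^{(2)} = exp(q_{i+2} − q_i)` of the periodic (2,1)-Toda Lax matrix. -/
noncomputable def todaA2 (q : ℤ → ℝ) (i : ℤ) : ℝ := Real.exp (q (i + 2) - q i)

/-- The entry `c_i^{(1)} = exp(q_{i+1} − q_i)` of the periodic (2,1)-Toda Lax matrix. -/
noncomputable def todaC1 (q : ℤ → ℝ) (i : ℤ) : ℝ := Real.exp (q (i + 1) - q i)

namespace Toda21

open Polynomial Equiv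

variable {n : ℕ}

/-- The winding number of the entry `(i, j)`: the Lax matrix carries `w ^ (-wrap i j)` there. -/
def wrap (i j : Fin n) : ℤ :=
  if i.1 = 0 ∧ j.1 = n - 1 then -1
  else if i.1 = n - 2 ∧ j.1 = 0 then 1
  else if i.1 = n - 1 ∧ j.1 = 0 then 1
  else if i.1 = n - 1 ∧ j.1 = 1 then 1
  else 0

/-- The displacement from `i` to `j` along the periodic chain. -/
def disp (i j : Fin n) : ℤ := j.1 - i.1 + n * wrap i j

/-- The entry `(i, j)` of `L(w) - X` with its power of `w` removed. -/
noncomputable def entry (q p ψ : ℤ → ℝ) (i j : Fin n) : ℝ[X] :=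
  if disp i j = 0 then C (p i.1) - X
  else if disp i j = 1 then C (todaA1 q ψ i.1)
  else if disp i j = 2 then C (todaA2 q i.1)
  else if disp i j = -1 then C (todaC1 q j.1)
  else 0

/-- The total winding number of a permutation. -/
def winding (σ : Perm (Fin n)) : ℤ := ∑ i, wrap (σ i) i

/-- The contribution of a permutation to the Leibniz expansion, with its power of `w` removed. -/
noncomputable def term (q p ψ : ℤ → ℝ) (σ : Perm (Fin n)) : ℝ[X] :=
  C ((Perm.sign σ : ℤ) : ℝ) * ∏ i, entry q p ψ (σ i) i

lemma disp_eq_zero_iff (hn : 5 ≤ n) (i j : Fin n) : disp i j = 0 ↔ i = j := by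
  have hi := i.2
  have hj := j.2
  rw [Fin.ext_iff]
  unfold disp wrap
  split_ifs <;> omega

lemma disp_wrap_cases (hn : 5 ≤ n) (i j : Fin n) :
    (i.1 = j.1 ∧ disp i j = 0 ∧ wrap i j = 0) ∨
    (j.1 = i.1 + 1 ∧ disp i j = 1 ∧ wrap i j = 0) ∨
    (j.1 = i.1 + 2 ∧ disp i j = 2 ∧ wrap i j = 0) ∨
    (i.1 = j.1 + 1 ∧ disp i j = -1 ∧ wrap i j = 0) ∨
    (i.1 = 0 ∧ j.1 = n - 1 ∧ disp i j = -1 ∧ wrap i j = -1) ∨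
    (i.1 = n - 2 ∧ j.1 = 0 ∧ disp i j = 2 ∧ wrap i j = 1) ∨
    (i.1 = n - 1 ∧ j.1 = 0 ∧ disp i j = 1 ∧ wrap i j = 1) ∨
    (i.1 = n - 1 ∧ j.1 = 1 ∧ disp i j = 2 ∧ wrap i j = 1) ∨
    (i.1 ≠ j.1 ∧ j.1 ≠ i.1 + 1 ∧ j.1 ≠ i.1 + 2 ∧ i.1 ≠ j.1 + 1 ∧ wrap i j = 0 ∧
      ¬(i.1 = 0 ∧ j.1 = n - 1) ∧ ¬(i.1 = n - 2 ∧ j.1 = 0) ∧ ¬(i.1 = n - 1 ∧ j.1 = 0) ∧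
      ¬(i.1 = n - 1 ∧ j.1 = 1) ∧
      disp i j ≠ 0 ∧ disp i j ≠ 1 ∧ disp i j ≠ 2 ∧ disp i j ≠ -1) := by
  have hi := i.2
  have hj := j.2
  by_cases h₁ : i.1 = 0 ∧ j.1 = n - 1
  · have hr : wrap i j = -1 := if_pos h₁
    have hd : disp i j = -1 := by rw [disp, hr]; omega
    exact .inr <| .inr <| .inr <| .inr <| .inl ⟨h₁.1, h₁.2, hd, hr⟩
  by_cases h₂ : i.1 = n - 2 ∧ j.1 = 0
  · have hr : wrap i j = 1 := by rw [wrap, if_neg h₁, if_pos h₂]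
    have hd : disp i j = 2 := by rw [disp, hr]; omega
    exact .inr <| .inr <| .inr <| .inr <| .inr <| .inl ⟨h₂.1, h₂.2, hd, hr⟩
  by_cases h₃ : i.1 = n - 1 ∧ j.1 = 0
  · have hr : wrap i j = 1 := by rw [wrap, if_neg h₁, if_neg h₂, if_pos h₃]
    have hd : disp i j = 1 := by rw [disp, hr]; omega
    exact .inr <| .inr <| .inr <| .inr <| .inr <| .inr <| .inl ⟨h₃.1, h₃.2, hd, hr⟩
  by_cases h₄ : i.1 = n - 1 ∧ j.1 = 1
  · have hr : wrap i j = 1 := by rw [wrap, if_neg h₁, if_neg h₂, if_neg h₃, if_pos h₄]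
    have hd : disp i j = 2 := by rw [disp, hr]; omega
    exact .inr <| .inr <| .inr <| .inr <| .inr <| .inr <| .inr <| .inl ⟨h₄.1, h₄.2, hd, hr⟩
  have hr : wrap i j = 0 := by rw [wrap, if_neg h₁, if_neg h₂, if_neg h₃, if_neg h₄]
  have hd : disp i j = j.1 - i.1 := by rw [disp, hr]; ring
  by_cases g₀ : i.1 = j.1
  · exact .inl ⟨g₀, by omega, hr⟩
  by_cases g₁ : j.1 = i.1 + 1
  · exact .inr <| .inl ⟨g₁, by omega, hr⟩
  by_cases g₂ : j.1 = i.1 + 2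
  · exact .inr <| .inr <| .inl ⟨g₂, by omega, hr⟩
  by_cases g₃ : i.1 = j.1 + 1
  · exact .inr <| .inr <| .inr <| .inl ⟨g₃, by omega, hr⟩
  exact .inr <| .inr <| .inr <| .inr <| .inr <| .inr <| .inr <| .inr
    ⟨g₀, g₁, g₂, g₃, hr, h₁, h₂, h₃, h₄, by omega, by omega, by omega, by omega⟩

lemma sum_disp (σ : Perm (Fin n)) : ∑ i, disp (σ i) i = n * winding σ := by
  have h : ∑ i, ((σ i).1 : ℤ) = ∑ i : Fin n, (i.1 : ℤ) := Equiv.sum_comp σ fun i => (i.1 : ℤ)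
  simp only [disp, winding, Finset.sum_add_distrib, Finset.sum_sub_distrib, h, Finset.mul_sum]
  ring

lemma disp_mem_of_entry_ne_zero {q p ψ : ℤ → ℝ} {i j : Fin n} (h : entry q p ψ i j ≠ 0) :
    -1 ≤ disp i j ∧ disp i j ≤ 2 := by
  unfold entry at h
  split_ifs at h <;> first | omega | exact absurd rfl h

lemma disp_mem_of_term_ne_zero {q p ψ : ℤ → ℝ} {σ : Perm (Fin n)} (h : term q p ψ σ ≠ 0)
    (i : Fin n) : -1 ≤ disp (σ i) i ∧ disp (σ i) i ≤ 2 :=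
  disp_mem_of_entry_ne_zero
    (Finset.prod_ne_zero_iff.mp (right_ne_zero_of_mul h) i (Finset.mem_univ i))

lemma winding_mem_of_term_ne_zero (hn : 5 ≤ n) {q p ψ : ℤ → ℝ} {σ : Perm (Fin n)}
    (h : term q p ψ σ ≠ 0) : -1 ≤ winding σ ∧ winding σ ≤ 2 := by
  have h₁ : ∑ _i : Fin n, (-1 : ℤ) ≤ ∑ i, disp (σ i) i :=
    Finset.sum_le_sum fun i _ => (disp_mem_of_term_ne_zero h i).1
  have h₂ : ∑ i, disp (σ i) i ≤ ∑ _i : Fin n, (2 : ℤ) :=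
    Finset.sum_le_sum fun i _ => (disp_mem_of_term_ne_zero h i).2
  rw [sum_disp] at h₁ h₂
  simp only [Finset.sum_const, Finset.card_univ, Fintype.card_fin, nsmul_eq_mul] at h₁ h₂
  have hn' : (0 : ℤ) < n := by omega
  exact ⟨le_of_mul_le_mul_left h₁ hn', le_of_mul_le_mul_left h₂ hn'⟩

lemma winding_eq_of_disp_eq (hn : 5 ≤ n) {σ : Perm (Fin n)} {k : ℤ}
    (h : ∀ i, disp (σ i) i = k) : winding σ = k := by
  have h' := sum_disp σ
  simp only [h, Finset.sum_const, Finset.card_univ, Fintype.card_fin, nsmul_eq_mul] at h'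
  exact (mul_left_cancel₀ (by omega : (n : ℤ) ≠ 0) h').symm

lemma disp_eq_neg_one_of_winding {q p ψ : ℤ → ℝ} {σ : Perm (Fin n)}
    (h : term q p ψ σ ≠ 0) (hw : winding σ = -1) (i : Fin n) : disp (σ i) i = -1 := by
  have hs : ∑ _i : Fin n, (-1 : ℤ) = ∑ i, disp (σ i) i := by
    rw [sum_disp, hw]
    simp
  exact ((Finset.sum_eq_sum_iff_of_le fun i _ => (disp_mem_of_term_ne_zero h i).1).mp hs i
    (Finset.mem_univ i)).symm

lemma disp_eq_two_of_winding {q p ψ : ℤ → ℝ} {σ : Perm (Fin n)}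
    (h : term q p ψ σ ≠ 0) (hw : winding σ = 2) (i : Fin n) : disp (σ i) i = 2 := by
  have hs : ∑ i, disp (σ i) i = ∑ _i : Fin n, (2 : ℤ) := by
    rw [sum_disp, hw]
    simp
  exact (Finset.sum_eq_sum_iff_of_le fun i _ => (disp_mem_of_term_ne_zero h i).2).mp hs i
    (Finset.mem_univ i)

lemma val_finRotate (i : Fin n) :
    (finRotate n i).1 = if i.1 + 1 = n then 0 else i.1 + 1 := by
  cases n with
  | zero => exact i.elim0
  | succ m =>
    rw [coe_finRotate]
    simp [Fin.ext_iff]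

lemma sign_finRotate_eq (hn : 5 ≤ n) : Perm.sign (finRotate n) = (-1) ^ (n - 1) := by
  obtain ⟨m, rfl⟩ : ∃ m, n = m + 1 := ⟨n - 1, by omega⟩
  simp

lemma disp_eq_neg_one_iff (hn : 5 ≤ n) (i j : Fin n) : disp i j = -1 ↔ i = finRotate n j := by
  have hi := i.2
  have hj := j.2
  rw [Fin.ext_iff, val_finRotate]
  unfold disp wrap
  split_ifs <;> omega

lemma disp_eq_two_iff (hn : 5 ≤ n) (i j : Fin n) :
    disp i j = 2 ↔ j = finRotate n (finRotate n i) := by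
  have hi := i.2
  have hj := j.2
  rw [Fin.ext_iff, val_finRotate, val_finRotate]
  unfold disp wrap
  split_ifs <;> omega

lemma disp_finRotate (hn : 5 ≤ n) (i : Fin n) : disp (finRotate n i) i = -1 :=
  (disp_eq_neg_one_iff hn _ _).mpr rfl

lemma disp_finRotate_sq_inv (hn : 5 ≤ n) (i : Fin n) :
    disp ((finRotate n * finRotate n)⁻¹ i) i = 2 :=
  (disp_eq_two_iff hn _ _).mpr ((finRotate n * finRotate n).apply_symm_apply i).symm

lemma sum_shift_sub {q : ℤ → ℝ} (hq : ∀ i : ℤ, q (i + n) = q i) :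
    ∑ i : Fin n, (q (i.1 + 1) - q i.1) = 0 := by
  rw [Fin.sum_univ_eq_sum_range (fun i : ℕ => q (i + 1) - q i) n]
  have h := Finset.sum_range_sub (fun i : ℕ => q i) n
  push_cast at h
  rw [h]
  simpa [sub_eq_zero] using hq 0

lemma prod_todaC1 {q : ℤ → ℝ} (hq : ∀ i : ℤ, q (i + n) = q i) :
    ∏ i : Fin n, todaC1 q i.1 = 1 := by
  simp only [todaC1]
  rw [← Real.exp_sum, sum_shift_sub hq, Real.exp_zero]

lemma prod_todaA2 {q : ℤ → ℝ} (hq : ∀ i : ℤ, q (i + n) = q i) :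
    ∏ i : Fin n, todaA2 q i.1 = 1 := by
  have hq' : ∀ i : ℤ, q (i + n + 1) = q (i + 1) := fun i => by
    rw [add_right_comm]
    exact hq (i + 1)
  have h := sum_shift_sub (n := n) (q := fun i => q (i + 1) + q i) fun i => by
    rw [hq, hq']
  simp only [todaA2]
  rw [← Real.exp_sum, ← Real.exp_zero, ← h]
  refine congrArg _ (Finset.sum_congr rfl fun i _ => ?_)
  rw [add_assoc, one_add_one_eq_two]
  ring

lemma term_finRotate (hn : 5 ≤ n) {q : ℤ → ℝ} (p ψ : ℤ → ℝ)
    (hq : ∀ i : ℤ, q (i + n) = q i) :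
    term q p ψ (finRotate n) = C ((-1) ^ (n - 1)) := by
  have h : ∏ i, entry q p ψ (finRotate n i) i = 1 := by
    simp only [entry, disp_finRotate hn]
    norm_num
    rw [← map_prod, prod_todaC1 hq, C_1]
  rw [term, h, sign_finRotate_eq hn]
  simp

lemma term_finRotate_sq_inv (hn : 5 ≤ n) {q : ℤ → ℝ} (p ψ : ℤ → ℝ)
    (hq : ∀ i : ℤ, q (i + n) = q i) :
    term q p ψ (finRotate n * finRotate n)⁻¹ = 1 := by
  have h : ∏ i, entry q p ψ ((finRotate n * finRotate n)⁻¹ i) i = 1 := by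
    have h' (i : Fin n) : entry q p ψ ((finRotate n * finRotate n)⁻¹ i) i =
        C (todaA2 q ((finRotate n * finRotate n)⁻¹ i).1) := by
      rw [entry, disp_finRotate_sq_inv hn]
      norm_num
    simp only [h']
    rw [Equiv.prod_comp (finRotate n * finRotate n)⁻¹ fun i => C (todaA2 q i.1),
      ← map_prod, prod_todaA2 hq, C_1]
  rw [term, h, Perm.sign_inv, Perm.sign_mul, Int.units_mul_self]
  simp

lemma sum_term_winding_neg_one (hn : 5 ≤ n) {q : ℤ → ℝ} (p ψ : ℤ → ℝ)
    (hq : ∀ i : ℤ, q (i + n) = q i) :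
    ∑ σ : Perm (Fin n) with winding σ = -1, term q p ψ σ = C ((-1) ^ (n - 1)) := by
  rw [← term_finRotate hn p ψ hq]
  refine Finset.sum_eq_single_of_mem _ ?_ fun σ hσ hne => ?_
  · simpa using winding_eq_of_disp_eq hn (disp_finRotate hn)
  · by_contra h
    exact hne (Equiv.ext fun i => (disp_eq_neg_one_iff hn _ _).mp
      (disp_eq_neg_one_of_winding h (by simpa using hσ) i))

lemma sum_term_winding_two (hn : 5 ≤ n) {q : ℤ → ℝ} (p ψ : ℤ → ℝ)
    (hq : ∀ i : ℤ, q (i + n) = q i) :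
    ∑ σ : Perm (Fin n) with winding σ = 2, term q p ψ σ = 1 := by
  rw [← term_finRotate_sq_inv hn p ψ hq]
  refine Finset.sum_eq_single_of_mem _ ?_ fun σ hσ hne => ?_
  · simpa using winding_eq_of_disp_eq hn (disp_finRotate_sq_inv hn)
  · by_contra h
    refine hne (eq_inv_of_mul_eq_one_right (Equiv.ext fun i => ?_))
    exact ((disp_eq_two_iff hn _ _).mp
      (disp_eq_two_of_winding h (by simpa using hσ) i)).symm

lemma natDegree_entry_le (hn : 5 ≤ n) (q p ψ : ℤ → ℝ) (i j : Fin n) :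
    (entry q p ψ i j).natDegree ≤ if i = j then 1 else 0 := by
  simp only [← disp_eq_zero_iff hn]
  unfold entry
  split_ifs <;> simp [natDegree_sub_le_iff_left]

lemma natDegree_term_le (hn : 5 ≤ n) (q p ψ : ℤ → ℝ) (σ : Perm (Fin n)) :
    (term q p ψ σ).natDegree ≤ ({i | σ i = i} : Finset (Fin n)).card := by
  refine (natDegree_C_mul_le _ _).trans ((natDegree_prod_le _ _).trans ?_)
  rw [Finset.card_filter]
  exact Finset.sum_le_sum fun i _ => natDegree_entry_le hn q p ψ (σ i) i

lemma degree_term_one (hn : 5 ≤ n) (q p ψ : ℤ → ℝ) :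
    (term q p ψ (1 : Perm (Fin n))).degree = n := by
  have h (i : Fin n) : entry q p ψ i i = C (p i.1) - X := by
    rw [entry, if_pos ((disp_eq_zero_iff hn i i).mpr rfl)]
  have h' (a : ℝ) : (C a - X : ℝ[X]).degree = 1 := by
    rw [← degree_neg, neg_sub, degree_X_sub_C]
  simp [term, h, h', degree_prod]

lemma degree_term_lt (hn : 5 ≤ n) (q p ψ : ℤ → ℝ) {σ : Perm (Fin n)} (hσ : σ ≠ 1) :
    (term q p ψ σ).degree < n := by
  refine degree_le_natDegree.trans_lt ?_
  rw [Nat.cast_lt]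
  refine (natDegree_term_le hn q p ψ σ).trans_lt ?_
  obtain ⟨i, hi⟩ : ∃ i, σ i ≠ i := by
    by_contra! h
    exact hσ (Equiv.ext h)
  simpa using Finset.card_lt_card
    (Finset.filter_ssubset (s := Finset.univ) (p := fun i => σ i = i) |>.mpr
      ⟨i, Finset.mem_univ i, hi⟩)

lemma degree_sum_term_winding_zero (hn : 5 ≤ n) (q p ψ : ℤ → ℝ) :
    (∑ σ : Perm (Fin n) with winding σ = 0, term q p ψ σ).degree = n := by
  have h1 : winding (1 : Perm (Fin n)) = 0 :=
    winding_eq_of_disp_eq hn fun i => (disp_eq_zero_iff hn _ _).mpr rfl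
  rw [← Finset.add_sum_erase _ _ (Finset.mem_filter.mpr ⟨Finset.mem_univ 1, h1⟩),
    degree_add_eq_left_of_degree_lt, degree_term_one hn]
  rw [degree_term_one hn]
  refine (degree_sum_le _ _).trans_lt ((Finset.sup_lt_iff (WithBot.bot_lt_coe n)).mpr ?_)
  exact fun σ hσ => degree_term_lt hn q p ψ (Finset.ne_of_mem_erase hσ)

lemma degree_sum_term_winding_one_le (hn : 5 ≤ n) (q p ψ : ℤ → ℝ) :
    (∑ σ : Perm (Fin n) with winding σ = 1, term q p ψ σ).degree ≤ ((n - 3 : ℕ) : WithBot ℕ) := by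
  refine (degree_sum_le _ _).trans (Finset.sup_le fun σ hσ => ?_)
  by_cases h : term q p ψ σ = 0
  · simp [h]
  have hw : winding σ = 1 := (Finset.mem_filter.mp hσ).2
  refine degree_le_natDegree.trans ?_
  rw [Nat.cast_le]
  refine (natDegree_term_le hn q p ψ σ).trans ?_
  have hle : ∑ i, disp (σ i) i ≤ ∑ i, (2 - 2 * if σ i = i then (1 : ℤ) else 0) := by
    refine Finset.sum_le_sum fun i _ => ?_
    split_ifs with hi
    · simp [(disp_eq_zero_iff hn _ _).mpr hi]
    · simpa using (disp_mem_of_term_ne_zero h i).2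
  rw [sum_disp, hw, Finset.sum_sub_distrib, ← Finset.mul_sum, Finset.sum_boole] at hle
  simp only [Finset.sum_const, Finset.card_univ, Fintype.card_fin, nsmul_eq_mul] at hle
  omega

/-- The Leibniz expansion grouped by winding number. -/
lemma sum_term_mul_zpow (hn : 5 ≤ n) (q p ψ : ℤ → ℝ) (lam w : ℂ) :
    ∑ σ : Perm (Fin n), aeval lam (term q p ψ σ) * w ^ (-winding σ) =
      aeval lam (∑ σ : Perm (Fin n) with winding σ = -1, term q p ψ σ) * w
      + aeval lam (∑ σ : Perm (Fin n) with winding σ = 1, term q p ψ σ) / w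
      + aeval lam (∑ σ : Perm (Fin n) with winding σ = 2, term q p ψ σ) / w ^ 2
      + aeval lam (∑ σ : Perm (Fin n) with winding σ = 0, term q p ψ σ) := by
  simp only [map_sum, Finset.sum_mul, Finset.sum_div, Finset.sum_filter,
    ← Finset.sum_add_distrib]
  refine Finset.sum_congr rfl fun σ _ => ?_
  by_cases h : term q p ψ σ = 0
  · simp [h]
  obtain ⟨h₁, h₂⟩ := winding_mem_of_term_ne_zero hn h
  generalize winding σ = k at h₁ h₂ ⊢
  interval_cases k <;> simp [zpow_neg, div_eq_mul_inv]

lemma det_eq_sum_term (q p ψ : ℤ → ℝ) (lam w : ℂ) (hw : w ≠ 0)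
    {M : Matrix (Fin n) (Fin n) ℂ}
    (hM : ∀ i j, M i j = aeval lam (entry q p ψ i j) * w ^ (-wrap i j)) :
    M.det = ∑ σ : Perm (Fin n), aeval lam (term q p ψ σ) * w ^ (-winding σ) := by
  rw [Matrix.det_apply']
  refine Finset.sum_congr rfl fun σ _ => ?_
  have h : w ^ (-winding σ) = ∏ i, w ^ (-wrap (σ i) i) := by
    rw [winding, ← Finset.sum_neg_distrib]
    generalize (Finset.univ : Finset (Fin n)) = s
    induction s using Finset.induction_on with
    | empty => simp
    | insert a s ha ih => rw [Finset.sum_insert ha, Finset.prod_insert ha, zpow_add₀ hw, ih]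
  simp only [hM, Finset.prod_mul_distrib, term, map_mul, map_prod, h, aeval_C]
  simp [mul_assoc]

end Toda21

/-- The characteristic polynomial of the Lax matrix `L(w)` of the
periodic `(2,1)`-Toda `n`-chain has the form
`det(L(w) − λ) = (−1)^{n−1}·w + Q(λ)/w + 1/w² + P(λ)` for real polynomials `P`, `Q`
independent of `w` with `deg P = n` and `deg Q ≤ n − 3`. -/
theorem toda21_spectral_curve (n : ℕ) (hn : 5 ≤ n)
    (q p ψ : ℤ → ℝ)
    (hq : ∀ i : ℤ, q (i + n) = q i) (hp : ∀ i : ℤ, p (i + n) = p i)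
    (hψ : ∀ i : ℤ, ψ (i + n) = ψ i)
    (L : ℂ → Matrix (Fin n) (Fin n) ℂ)
    (hL : ∀ w : ℂ, L w = Matrix.of fun i j : Fin n =>
      if i.1 = j.1 then (p (i.1 : ℤ) : ℂ)
      else if j.1 = i.1 + 1 then (todaA1 q ψ (i.1 : ℤ) : ℂ)
      else if j.1 = i.1 + 2 then (todaA2 q (i.1 : ℤ) : ℂ)
      else if i.1 = j.1 + 1 then (todaC1 q (j.1 : ℤ) : ℂ)
      else if i.1 = 0 ∧ j.1 = n - 1 then w * (todaC1 q ((n : ℤ) - 1) : ℂ)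
      else if i.1 = n - 2 ∧ j.1 = 0 then w⁻¹ * (todaA2 q ((n : ℤ) - 2) : ℂ)
      else if i.1 = n - 1 ∧ j.1 = 0 then w⁻¹ * (todaA1 q ψ ((n : ℤ) - 1) : ℂ)
      else if i.1 = n - 1 ∧ j.1 = 1 then w⁻¹ * (todaA2 q ((n : ℤ) - 1) : ℂ)
      else 0) :
    ∃ P Q : Polynomial ℝ,
      P.degree = (n : WithBot ℕ) ∧ Q.degree ≤ ((n - 3 : ℕ) : WithBot ℕ) ∧
      ∀ lam w : ℂ, w ≠ 0 →
        Matrix.det (L w - lam • (1 : Matrix (Fin n) (Fin n) ℂ)) =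
          (-1 : ℂ) ^ (n - 1) * w + (Polynomial.aeval lam Q) / w + 1 / w ^ 2
            + Polynomial.aeval lam P := by
  refine ⟨_, _, Toda21.degree_sum_term_winding_zero hn q p ψ,
    Toda21.degree_sum_term_winding_one_le hn q p ψ, fun lam w hw => ?_⟩
  have hM (i j : Fin n) : (L w - lam • (1 : Matrix (Fin n) (Fin n) ℂ)) i j =
      Polynomial.aeval lam (Toda21.entry q p ψ i j) * w ^ (-Toda21.wrap i j) := by
    have hi := i.2
    have hj := j.2
    have hn₁ : ((n - 1 : ℕ) : ℤ) = (n : ℤ) - 1 := by omega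
    have hn₂ : ((n - 2 : ℕ) : ℤ) = (n : ℤ) - 2 := by omega
    rw [hL, Matrix.sub_apply, Matrix.smul_apply, Matrix.one_apply, Matrix.of_apply,
      Toda21.entry]
    simp only [Fin.ext_iff]
    rcases Toda21.disp_wrap_cases hn i j with
      ⟨h, hd, hr⟩ | ⟨h, hd, hr⟩ | ⟨h, hd, hr⟩ | ⟨h, hd, hr⟩ | ⟨h, h', hd, hr⟩ | ⟨h, h', hd, hr⟩ |
      ⟨h, h', hd, hr⟩ | ⟨h, h', hd, hr⟩ | ⟨h₁, h₂, h₃, h₄, hr, h₅, h₆, h₇, h₈, h₉, h₁₀, h₁₁, h₁₂⟩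
    · rw [if_pos h, if_pos h, hd, hr]
      simp [h]
    · rw [if_neg (by omega), if_pos h, if_neg (by omega), hd, hr]
      simp
    · rw [if_neg (by omega), if_neg (by omega), if_pos h, if_neg (by omega), hd, hr]
      simp
    · rw [if_neg (by omega), if_neg (by omega), if_neg (by omega), if_pos h, if_neg (by omega),
        hd, hr]
      simp
    · rw [if_neg (by omega), if_neg (by omega), if_neg (by omega), if_neg (by omega),
        if_pos ⟨h, h'⟩, if_neg (by omega), hd, hr]
      simp [h', hn₁, mul_comm]
    · rw [if_neg (by omega), if_neg (by omega), if_neg (by omega), if_neg (by omega),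
        if_neg (by omega), if_pos ⟨h, h'⟩, if_neg (by omega), hd, hr]
      simp [h, hn₂, mul_comm]
    · rw [if_neg (by omega), if_neg (by omega), if_neg (by omega), if_neg (by omega),
        if_neg (by omega), if_neg (by omega), if_pos ⟨h, h'⟩, if_neg (by omega), hd, hr]
      simp [h, hn₁, mul_comm]
    · rw [if_neg (by omega), if_neg (by omega), if_neg (by omega), if_neg (by omega),
        if_neg (by omega), if_neg (by omega), if_neg (by omega), if_pos ⟨h, h'⟩,
        if_neg (by omega), hd, hr]
      simp [h, hn₁, mul_comm]
    · simp only [*, if_false, map_zero, smul_zero, sub_zero, zero_mul]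
  rw [Toda21.det_eq_sum_term q p ψ lam w hw hM, Toda21.sum_term_mul_zpow hn,
    Toda21.sum_term_winding_neg_one hn p ψ hq, Toda21.sum_term_winding_two hn p ψ hq]
  simp
end

section
/- Fix integers n ≥ 2 and m₊, m₋ with 1 ≤ m₋ ≤ m₊ ≤ n − 1. Let q_i : ℝ → ℝ (1 ≤ i ≤ n) be twice differentiable and ψ_i^{+(k)}, ψ_i^{−(k)} : ℝ → ℝ be differentiable for in-range indices, with conventions ψ_i^{+(m₊)} := 1, ψ_i^{−(m₋)} := 1 for in-range i and ψ_i^{±(k)} := 0 and exp-terms with indices outside {1,…,n} set to 0. Suppose that for all t the equations of motion of the finite (m₊,m₋)-Toda n-chain hold: q̈_i = 2 Σ_{k=1}^{m₋} { ψ_i^{+(k)}ψ_i^{−(k)} exp[2(q_{i+k} − q_i)] − ψ_{i−k}^{−(k)}ψ_{i−k}^{+(k)} exp[2(q_i − q_{i−k})] }, ψ̇_i^{+(k)} = 2 Σ_{k'=1}^{min(m₊−k,m₋)} ( ψ_i^{+(k+k')}ψ_{i+k}^{−(k')} exp[2(q_{i+k+k'} − q_{i+k})] − ψ_{i−k'}^{−(k')}ψ_{i−k'}^{+(k+k')}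 exp[2(q_i − q_{i−k'})] ) for 1 ≤ k ≤ m₊ − 1, and ψ̇_i^{−(k)} = 2 Σ_{k'=1}^{m₋−k} ( ψ_{i+k}^{+(k')}ψ_i^{−(k+k')} exp[2(q_{i+k+k'} − q_{i+k})] − ψ_{i−k'}^{−(k+k')}ψ_{i−k'}^{+(k')} exp[2(q_i − q_{i−k'})] ) for 1 ≤ k ≤ m₋ − 1. Then the function H₂(t) := (1/2) Σ_{i=1}^{n} q̇_i(t)² + Σ_{k=1}^{m₋} Σ_{i=1}^{n−k} exp[2(q_{i+k}(t) − q_i(t))]·ψ_i^{+(k)}(t)·ψ_i^{−(k)}(t) is constant in t. -/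
open Finset

/-- Shifting the summation index by `k`, for a summand vanishing off the chain `{1, …, n}`. -/
theorem sum_Icc_sub_eq_sum_Icc_add {n k : ℕ} (F : ℕ → ℕ → ℝ) (h0 : ∀ i, F i 0 = 0)
    (hF : ∀ j, n < j + k → F (j + k) j = 0) :
    ∑ i ∈ Icc 1 n, F i (i - k) = ∑ j ∈ Icc 1 n, F (j + k) j := by
  symm
  refine sum_bij_ne_zero (fun j _ _ => j + k) ?_ ?_ ?_ ?_
  · intro j hj hne
    have : ¬ n < j + k := fun h => hne (hF j h)
    simp only [mem_Icc] at hj ⊢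
    omega
  · intro i _ _ j _ _ h
    exact Nat.add_right_cancel h
  · intro i hi hne
    have hpos : i - k ≠ 0 := by
      intro h
      exact hne (by rw [h, h0])
    have hik : i - k + k = i := by omega
    refine ⟨i - k, ?_, ?_, hik⟩
    · simp only [mem_Icc] at hi ⊢
      omega
    · rwa [hik]
  · intro j _ _
    simp

theorem sum_Icc_sub_eq_sum_Icc {n k : ℕ} (f : ℕ → ℝ) (hf : ∀ i, n < i + k → f i = 0) :
    ∑ i ∈ Icc 1 (n - k), f i = ∑ i ∈ Icc 1 n, f i := by
  refine sum_subset (Icc_subset_Icc_right (Nat.sub_le n k)) fun i hi hi' => hf i ?_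
  simp only [mem_Icc] at hi hi'
  omega

/-- The kinetic and exponential contributions to the time derivative of `H₂` cancel. -/
theorem sum_mul_force_eq (n M : ℕ) (q p : ℕ → ℝ) (u v : ℕ → ℕ → ℝ)
    (hu : ∀ k i : ℕ, (i < 1 ∨ i + k > n) → u k i = 0) :
    ∑ i ∈ Icc 1 n, p i * ∑ k ∈ Icc 1 M,
        (u k i * v k i * Real.exp (2 * (q (i + k) - q i))
          - v k (i - k) * u k (i - k) * Real.exp (2 * (q i - q (i - k))))
      = - ∑ k ∈ Icc 1 M, ∑ i ∈ Icc 1 (n - k),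
          (p (i + k) - p i) * Real.exp (2 * (q (i + k) - q i)) * u k i * v k i := by
  simp only [mul_sum]
  rw [sum_comm, ← sum_neg_distrib]
  refine sum_congr rfl fun k _ => ?_
  rw [sum_Icc_sub_eq_sum_Icc _ fun i hi => by rw [hu k i (Or.inr hi)]; ring]
  simp only [mul_sub, sum_sub_distrib]
  rw [sum_Icc_sub_eq_sum_Icc_add
    (fun i j => p i * (v k j * u k j * Real.exp (2 * q i - 2 * q j)))
    (fun i => by simp [hu k 0 (Or.inl Nat.zero_lt_one)])
    (fun j hj => by simp [hu k j (Or.inr hj)]), ← sum_sub_distrib, ← sum_neg_distrib]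
  exact sum_congr rfl fun i _ => by ring

/-- The contribution of the equations of motion of one family of `ψ` variables to the time
derivative of `H₂` vanishes, by antisymmetry in the two band indices. -/
theorem sum_exp_mul_interaction_eq_zero (n M N : ℕ) (q : ℕ → ℝ) (u v : ℕ → ℕ → ℝ)
    (hu : ∀ k i : ℕ, (i < 1 ∨ i + k > n) → u k i = 0)
    (hv : ∀ k i : ℕ, (i < 1 ∨ i + k > n) → v k i = 0) :
    ∑ k ∈ Icc 1 M, ∑ i ∈ Icc 1 (n - k),
      Real.exp (2 * (q (i + k) - q i)) * v k i * ∑ k' ∈ Icc 1 M with k + k' ≤ N,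
        (u (k + k') i * v k' (i + k) * Real.exp (2 * (q (i + k + k') - q (i + k)))
          - v k' (i - k') * u (k + k') (i - k') * Real.exp (2 * (q i - q (i - k')))) = 0 := by
  set T : ℕ → ℕ → ℕ → ℝ := fun k k' i =>
    Real.exp (2 * (q (i + k + k') - q i)) * u (k + k') i * v k i * v k' (i + k) with hT
  have key : ∀ k k', ∑ i ∈ Icc 1 n, Real.exp (2 * (q (i + k) - q i)) * v k i *
        (u (k + k') i * v k' (i + k) * Real.exp (2 * (q (i + k + k') - q (i + k)))
          - v k' (i - k') * u (k + k') (i - k') * Real.exp (2 * (q i - q (i - k'))))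
      = ∑ i ∈ Icc 1 n, T k k' i - ∑ i ∈ Icc 1 n, T k' k i := by
    intro k k'
    simp only [mul_sub, sum_sub_distrib]
    rw [sum_Icc_sub_eq_sum_Icc_add
      (fun i j => Real.exp (2 * q (i + k) - 2 * q i) * v k i *
        (v k' j * u (k + k') j * Real.exp (2 * q i - 2 * q j)))
      (fun i => by simp [hu _ 0 (Or.inl Nat.zero_lt_one)])
      (fun j hj => by simp [hv k' j (Or.inr hj)])]
    congr 1 <;> refine sum_congr rfl fun i _ => ?_
    · have : Real.exp (2 * (q (i + k + k') - q i)) = Real.exp (2 * q (i + k) - 2 * q i) *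
          Real.exp (2 * q (i + k + k') - 2 * q (i + k)) := by
        rw [← Real.exp_add]; ring_nf
      simp only [hT, this]
      ring
    · have : Real.exp (2 * (q (i + k' + k) - q i)) = Real.exp (2 * q (i + k' + k) - 2 * q (i + k'))
          * Real.exp (2 * q (i + k') - 2 * q i) := by
        rw [← Real.exp_add]; ring_nf
      simp only [hT, this, add_comm k' k]
      ring
  calc _ = ∑ k ∈ Icc 1 M, ∑ k' ∈ Icc 1 M, if k + k' ≤ N then
          ∑ i ∈ Icc 1 n, T k k' i - ∑ i ∈ Icc 1 n, T k' k i else 0 := by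
        refine sum_congr rfl fun k _ => ?_
        rw [sum_Icc_sub_eq_sum_Icc _ fun i hi => by rw [hv k i (Or.inr hi)]; ring]
        simp only [mul_sum]
        rw [sum_comm, sum_filter]
        exact sum_congr rfl fun k' _ => by rw [key]
    _ = 0 := by
        refine self_eq_neg.mp ?_
        conv_lhs => rw [sum_comm]
        rw [← sum_neg_distrib]
        refine sum_congr rfl fun k _ => ?_
        rw [← sum_neg_distrib]
        refine sum_congr rfl fun k' _ => ?_
        rw [add_comm k' k]
        split_ifs <;> ring


/-- Along any solution of the equations of motion of the finite abelian
`(m₊,m₋)`-Toda `n`-chain, the second integral of motion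
`H₂(t) = (1/2)Σᵢ q̇ᵢ² + Σ_{k=1}^{m₋} Σ_{i=1}^{n−k} exp[2(q_{i+k} − q_i)] ψ⁺ ψ⁻`
is constant in `t`.  Conventions: `ψp mp i = 1`, `ψm mm i = 1` for in-range `i`, and
`ψp k i = ψm k i = 0` whenever `i < 1` or `i + k > n`. -/
theorem toda_H2_conserved
    (n mp mm : ℕ) (hn : 2 ≤ n) (hmm : 1 ≤ mm) (hmmmp : mm ≤ mp) (hmp : mp ≤ n - 1)
    (q : ℕ → ℝ → ℝ) (ψp ψm : ℕ → ℕ → ℝ → ℝ)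
    (hqd : ∀ i : ℕ, 1 ≤ i → i ≤ n →
      Differentiable ℝ (q i) ∧ Differentiable ℝ (deriv (q i)))
    (hψpd : ∀ k i : ℕ, 1 ≤ k → k ≤ mp - 1 → 1 ≤ i → i + k ≤ n →
      Differentiable ℝ (ψp k i))
    (hψmd : ∀ k i : ℕ, 1 ≤ k → k ≤ mm - 1 → 1 ≤ i → i + k ≤ n →
      Differentiable ℝ (ψm k i))
    (hψptop : ∀ i : ℕ, 1 ≤ i → i + mp ≤ n → ψp mp i = fun _ => (1 : ℝ))
    (hψmtop : ∀ i : ℕ, 1 ≤ i → i + mm ≤ n → ψm mm i = fun _ => (1 : ℝ))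
    (hψp0 : ∀ k i : ℕ, (i < 1 ∨ i + k > n) → ψp k i = 0)
    (hψm0 : ∀ k i : ℕ, (i < 1 ∨ i + k > n) → ψm k i = 0)
    (heq1 : ∀ t : ℝ, ∀ i : ℕ, 1 ≤ i → i ≤ n →
      deriv (deriv (q i)) t = 2 * ∑ k ∈ Finset.Icc 1 mm,
        (ψp k i t * ψm k i t * Real.exp (2 * (q (i + k) t - q i t))
          - ψm k (i - k) t * ψp k (i - k) t * Real.exp (2 * (q i t - q (i - k) t))))
    (heq2 : ∀ t : ℝ, ∀ k i : ℕ, 1 ≤ k → k ≤ mp - 1 → 1 ≤ i → i + k ≤ n →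
      deriv (ψp k i) t = 2 * ∑ k' ∈ Finset.Icc 1 (min (mp - k) mm),
        (ψp (k + k') i t * ψm k' (i + k) t
            * Real.exp (2 * (q (i + k + k') t - q (i + k) t))
          - ψm k' (i - k') t * ψp (k + k') (i - k') t
            * Real.exp (2 * (q i t - q (i - k') t))))
    (heq3 : ∀ t : ℝ, ∀ k i : ℕ, 1 ≤ k → k ≤ mm - 1 → 1 ≤ i → i + k ≤ n →
      deriv (ψm k i) t = 2 * ∑ k' ∈ Finset.Icc 1 (mm - k),
        (ψp k' (i + k) t * ψm (k + k') i t
            * Real.exp (2 * (q (i + k + k') t - q (i + k) t))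
          - ψm (k + k') (i - k') t * ψp k' (i - k') t
            * Real.exp (2 * (q i t - q (i - k') t)))) :
    ∀ t₁ t₂ : ℝ,
      ((1 / 2 : ℝ) * ∑ i ∈ Finset.Icc 1 n, (deriv (q i) t₁) ^ 2
          + ∑ k ∈ Finset.Icc 1 mm, ∑ i ∈ Finset.Icc 1 (n - k),
              Real.exp (2 * (q (i + k) t₁ - q i t₁)) * ψp k i t₁ * ψm k i t₁)
        = ((1 / 2 : ℝ) * ∑ i ∈ Finset.Icc 1 n, (deriv (q i) t₂) ^ 2
          + ∑ k ∈ Finset.Icc 1 mm, ∑ i ∈ Finset.Icc 1 (n - k),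
              Real.exp (2 * (q (i + k) t₂ - q i t₂)) * ψp k i t₂ * ψm k i t₂) := by
  have hfp : ∀ k, (Icc 1 mm).filter (fun k' => k + k' ≤ mp) = Icc 1 (min (mp - k) mm) := by
    intro k
    ext k'
    simp only [mem_filter, mem_Icc]
    omega
  have hfm : ∀ k, (Icc 1 mm).filter (fun k' => k + k' ≤ mm) = Icc 1 (mm - k) := by
    intro k
    ext k'
    simp only [mem_filter, mem_Icc]
    omega
  have hdp : ∀ t k i, 1 ≤ k → k ≤ mm → 1 ≤ i → i + k ≤ n → HasDerivAt (ψp k i)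
      (2 * ∑ k' ∈ Icc 1 mm with k + k' ≤ mp,
        (ψp (k + k') i t * ψm k' (i + k) t
            * Real.exp (2 * (q (i + k + k') t - q (i + k) t))
          - ψm k' (i - k') t * ψp (k + k') (i - k') t
            * Real.exp (2 * (q i t - q (i - k') t)))) t := by
    intro t k i hk hkm hi hik
    rw [hfp]
    rcases eq_or_ne k mp with rfl | hne
    · simpa [hψptop i hi hik] using hasDerivAt_const t (1 : ℝ)
    · rw [← heq2 t k i hk (by omega) hi hik]
      exact (hψpd k i hk (by omega) hi hik t).hasDerivAt
  have hdm : ∀ t k i, 1 ≤ k → k ≤ mm → 1 ≤ i → i + k ≤ n → HasDerivAt (ψm k i)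
      (2 * ∑ k' ∈ Icc 1 mm with k + k' ≤ mm,
        (ψm (k + k') i t * ψp k' (i + k) t
            * Real.exp (2 * (q (i + k + k') t - q (i + k) t))
          - ψp k' (i - k') t * ψm (k + k') (i - k') t
            * Real.exp (2 * (q i t - q (i - k') t)))) t := by
    intro t k i hk hkm hi hik
    rw [hfm]
    rcases eq_or_ne k mm with rfl | hne
    · simpa [hψmtop i hi hik] using hasDerivAt_const t (1 : ℝ)
    · have h := (hψmd k i hk (by omega) hi hik t).hasDerivAt
      rw [heq3 t k i hk (by omega) hi hik] at h
      refine h.congr_deriv ?_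
      congr 1
      exact sum_congr rfl fun k' _ => by ring
  have hH : ∀ t, HasDerivAt (fun s => (1 / 2 : ℝ) * ∑ i ∈ Icc 1 n, (deriv (q i) s) ^ 2
      + ∑ k ∈ Icc 1 mm, ∑ i ∈ Icc 1 (n - k),
          Real.exp (2 * (q (i + k) s - q i s)) * ψp k i s * ψm k i s) 0 t := by
    intro t
    have hkin := (HasDerivAt.fun_sum fun i (hi : i ∈ Icc 1 n) =>
      ((hqd i (mem_Icc.mp hi).1 (mem_Icc.mp hi).2).2 t).hasDerivAt.fun_pow 2).const_mul (1 / 2 : ℝ)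
    have hpot := HasDerivAt.fun_sum fun k (hk : k ∈ Icc 1 mm) =>
      HasDerivAt.fun_sum fun i (hi : i ∈ Icc 1 (n - k)) => by
        have hk' := mem_Icc.mp hk
        have hi' := mem_Icc.mp hi
        have hq₁ := ((hqd (i + k) (by omega) (by omega)).1 t).hasDerivAt
        have hq₂ := ((hqd i (by omega) (by omega)).1 t).hasDerivAt
        exact (((hq₁.fun_sub hq₂).const_mul 2).exp.fun_mul
          (hdp t k i hk'.1 hk'.2 hi'.1 (by omega))).fun_mul
          (hdm t k i hk'.1 hk'.2 hi'.1 (by omega))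
    refine (hkin.fun_add hpot).congr_deriv ?_
    have hforce := sum_mul_force_eq n mm (fun i => q i t) (fun i => deriv (q i) t)
      (fun k i => ψp k i t) (fun k i => ψm k i t) (fun k i h => by simp [hψp0 k i h])
    have hplus := sum_exp_mul_interaction_eq_zero n mm mp (fun i => q i t)
      (fun k i => ψp k i t) (fun k i => ψm k i t)
      (fun k i h => by simp [hψp0 k i h]) (fun k i h => by simp [hψm0 k i h])
    have hminus := sum_exp_mul_interaction_eq_zero n mm mm (fun i => q i t)
      (fun k i => ψm k i t) (fun k i => ψp k i t)
      (fun k i h => by simp [hψm0 k i h]) (fun k i h => by simp [hψp0 k i h])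
    have hkin_eq : (1 / 2 : ℝ) * ∑ i ∈ Icc 1 n,
          ((2 : ℕ) : ℝ) * deriv (q i) t ^ (2 - 1) * deriv (deriv (q i)) t
        = 2 * ∑ i ∈ Icc 1 n, deriv (q i) t * ∑ k ∈ Icc 1 mm,
          (ψp k i t * ψm k i t * Real.exp (2 * (q (i + k) t - q i t))
            - ψm k (i - k) t * ψp k (i - k) t * Real.exp (2 * (q i t - q (i - k) t))) := by
      rw [mul_sum, mul_sum]
      refine sum_congr rfl fun i hi => ?_
      rw [heq1 t i (mem_Icc.mp hi).1 (mem_Icc.mp hi).2]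
      norm_num
      ring
    rw [hkin_eq, hforce]
    have hzero := congrArg₂ (fun x y : ℝ => 2 * x + 2 * y) hplus hminus
    simp only [mul_zero, add_zero] at hzero
    rw [← hzero, mul_neg, neg_add_eq_iff_eq_add, mul_sum, mul_sum, mul_sum,
      ← sum_add_distrib, ← sum_add_distrib]
    refine sum_congr rfl fun k _ => ?_
    rw [mul_sum, mul_sum, mul_sum, ← sum_add_distrib, ← sum_add_distrib]
    exact sum_congr rfl fun i _ => by ring
  exact is_const_of_deriv_eq_zero (fun t => (hH t).differentiableAt) (fun t => (hH t).deriv)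
end
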